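/- Every Bayesian game with finite actions that has coarser inter-player information possesses a pure strategy equilibrium: there exist measurable f_i* : T_i → X_i, i = 1,…,n, such that for every player i and every measurable g_i : T_i → X_i, U_i(f*) ≥ U_i(g_i, f*_{-i}). -/

import Mathlib

open MeasureTheory Filter Topology Set
open scoped ENNReal

noncomputable section

/-- `D` is a `𝒢`-atom of `𝒯` under `μ`. -/
def IsCondAtom {T : Type*} (mT G : MeasurableSpace T) (μ : @MeasureTheory.Measure T mT)
    (D : Set T) : Prop :=
  MeasurableSet[mT] D ∧ 0 < μ D ∧
    ∀ D₀ : Set T, MeasurableSet[mT] D₀ → D₀ ⊆ D →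
      ∃ D₁ : Set T, MeasurableSet[G] D₁ ∧ μ (symmDiff D₀ (D₁ ∩ D)) = 0

/-- `𝒯` has no `𝒢`-atom under `μ`. -/
def HasNoCondAtom {T : Type*} (mT G : MeasurableSpace T) (μ : @MeasureTheory.Measure T mT) :
    Prop :=
  ∀ D : Set T, ¬ IsCondAtom mT G μ D

/-- A measure is atomless if every measurable set of positive measure has a measurable
subset of strictly smaller positive measure. -/
def AtomlessMeasure {T : Type*} {mT : MeasurableSpace T} (μ : Measure T) : Prop :=
  ∀ A : Set T, MeasurableSet A → 0 < μ A →
    ∃ B : Set T, MeasurableSet B ∧ B ⊆ A ∧ 0 < μ B ∧ μ B < μ A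

/-- The density weighted payoff `w_i(x, t) = u_i(x, t) * q(t)`. -/
def dwPayoff {n : ℕ} {T X : Fin n → Type*}
    (u : Fin n → (∀ i, X i) → (∀ i, T i) → ℝ) (q : (∀ i, T i) → ℝ)
    (i : Fin n) (x : ∀ k, X k) (t : ∀ k, T k) : ℝ :=
  u i x t * q t

/-- Player `i`'s inter-player information `𝒢_i`: the σ-algebra on `T i` generated by the
maps `t_i ↦ w_j(x, (t_i, t_{-i}))` for all `j ≠ i`, action profiles `x` and `t_{-i}`. -/
def interInfo {n : ℕ} {T X : Fin n → Type*}
    (u : Fin n → (∀ i, X i) → (∀ i, T i) → ℝ) (q : (∀ i, T i) → ℝ) (i : Fin n) :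
    MeasurableSpace (T i) :=
  ⨆ (j : Fin n) (_ : j ≠ i) (x : ∀ k, X k) (s : ∀ k, T k),
    MeasurableSpace.comap (fun ti : T i => dwPayoff u q j x (Function.update s i ti))
      inferInstance

/-- A pure strategy is measurable: each action has a measurable preimage. -/
def IsPureStrategy {A B : Type*} [MeasurableSpace A] (f : A → B) : Prop :=
  ∀ b : B, MeasurableSet {a | f a = b}

/-- Player `i`'s expected payoff from a pure strategy profile `f`. -/
def purePayoff {n : ℕ} {T X : Fin n → Type*} [∀ i, MeasurableSpace (T i)]
    (lam : Measure (∀ i, T i)) (u : Fin n → (∀ i, X i) → (∀ i, T i) → ℝ)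
    (f : ∀ i, T i → X i) (i : Fin n) : ℝ :=
  ∫ t, u i (fun j => f j (t j)) t ∂lam

/-- `f` is a pure strategy equilibrium. -/
def IsPureEquilibrium {n : ℕ} {T X : Fin n → Type*} [∀ i, MeasurableSpace (T i)]
    (lam : Measure (∀ i, T i)) (u : Fin n → (∀ i, X i) → (∀ i, T i) → ℝ)
    (f : ∀ i, T i → X i) : Prop :=
  (∀ i, IsPureStrategy (f i)) ∧
    ∀ (i : Fin n) (g : T i → X i), IsPureStrategy g →
      purePayoff lam u (Function.update f i g) i ≤ purePayoff lam u f i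

section Brouwer

/-- The determinant along an affine line `s ↦ id + s • A` is a polynomial in `s` of degree at most
the dimension. -/
lemma exists_polynomial_det_id_add_smul {E : Type*} [NormedAddCommGroup E] [NormedSpace ℝ E]
    [FiniteDimensional ℝ E] (A : E →L[ℝ] E) :
    ∃ P : Polynomial ℝ, P.degree < (Module.finrank ℝ E + 1 : ℕ) ∧
      ∀ s : ℝ, P.eval s = (ContinuousLinearMap.id ℝ E + s • A).det := by
  classical
  let b := Module.finBasis ℝ E
  let M := LinearMap.toMatrix b b (A : E →ₗ[ℝ] E)
  let I : Matrix (Fin (Module.finrank ℝ E)) (Fin (Module.finrank ℝ E)) ℝ := 1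
  refine ⟨((Polynomial.X : Polynomial ℝ) • M.map Polynomial.C + I.map Polynomial.C).det, ?_, ?_⟩
  · refine lt_of_le_of_lt Polynomial.degree_le_natDegree ?_
    have := Polynomial.natDegree_det_X_add_C_le M I
    rw [Fintype.card_fin] at this
    exact_mod_cast Nat.lt_succ_of_le this
  · intro s
    rw [ContinuousLinearMap.det, ← LinearMap.det_toMatrix b, ← Polynomial.coe_evalRingHom,
      RingHom.map_det]
    congr 1
    have h1 : ((ContinuousLinearMap.id ℝ E + s • A : E →L[ℝ] E) : E →ₗ[ℝ] E)
        = LinearMap.id + s • (A : E →ₗ[ℝ] E) := rfl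
    have h2 : LinearMap.toMatrix b b (LinearMap.id + s • (A : E →ₗ[ℝ] E)) = I + s • M := by
      rw [map_add, map_smul, LinearMap.toMatrix_id]
    rw [h1, h2]
    ext i j
    simp [M, I, Matrix.one_apply, apply_ite, add_comm]
    exact mul_comm _ _

lemma det_id_add_smul_pos {E : Type*} [NormedAddCommGroup E] [NormedSpace ℝ E]
    [FiniteDimensional ℝ E] (A : E →L[ℝ] E) {t : ℝ} (ht : 0 ≤ t) (hA : t * ‖A‖ < 1) :
    0 < (ContinuousLinearMap.id ℝ E + t • A).det := by
  obtain ⟨P, -, hP⟩ := exists_polynomial_det_id_add_smul A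
  have hne : ∀ s ∈ Icc 0 t, P.eval s ≠ 0 := by
    intro s hs h0
    rw [hP, ContinuousLinearMap.det] at h0
    have hlt := LinearMap.bot_lt_ker_of_det_eq_zero h0
    obtain ⟨v, hv, hv0⟩ := (Submodule.ne_bot_iff _).1 hlt.ne'
    have h1 : v + s • A v = 0 := by simpa using hv
    have h2 : ‖v‖ = s * ‖A v‖ := by
      have := congrArg norm (eq_neg_of_add_eq_zero_left h1)
      rwa [norm_neg, norm_smul, Real.norm_of_nonneg hs.1] at this
    have h3 : s * ‖A v‖ ≤ t * (‖A‖ * ‖v‖) :=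
      mul_le_mul hs.2 (A.le_opNorm v) (norm_nonneg _) ht
    have h4 : 0 < ‖v‖ := norm_pos_iff.2 hv0
    nlinarith
  rw [← hP]
  by_contra hcon
  have h0 : P.eval 0 = 1 := by rw [hP]; simp [ContinuousLinearMap.det]
  obtain ⟨s, hs, hs0⟩ := intermediate_value_Icc' (f := fun s => P.eval s) ht
    P.continuous.continuousOn (show (0 : ℝ) ∈ Icc (P.eval t) (P.eval 0) by
      constructor <;> linarith)
  exact hne s hs hs0

/-- There is no retraction of a closed ball onto its sphere that is Lipschitz and differentiable
in the interior. -/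
lemma no_lipschitz_retraction {E : Type*} [NormedAddCommGroup E] [InnerProductSpace ℝ E]
    [FiniteDimensional ℝ E] {R : ℝ} (hR : 0 < R) (K : E → E)
    (hd : ∀ x ∈ Metric.ball (0 : E) R, DifferentiableAt ℝ K x) {C : NNReal}
    (hL : LipschitzOnWith C K (Metric.closedBall 0 R))
    (hs : ∀ x, ‖x‖ = R → K x = x) (hn : ∀ x, ‖x‖ ≤ R → ‖K x‖ = R) : False := by
  let : MeasurableSpace E := borel E
  have : BorelSpace E := ⟨rfl⟩
  let μ : Measure E := Measure.addHaar
  let B := Metric.ball (0 : E) R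
  let h : E → E := fun x => K x - x
  let A : E → E →L[ℝ] E := fun x => fderiv ℝ h x
  have hLh : LipschitzOnWith (C + 1) h (Metric.closedBall 0 R) :=
    hL.sub (LipschitzWith.id.lipschitzOnWith)
  have hdh : ∀ x ∈ B, HasFDerivAt h (A x) x := fun x hx =>
    ((hd x hx).sub differentiableAt_id).hasFDerivAt
  have hAn : ∀ x ∈ B, ‖A x‖ ≤ (C : ℝ) + 1 := by
    intro x hx
    have := norm_fderiv_le_of_lipschitzOn ℝ (Metric.isOpen_ball.mem_nhds hx)
      (hLh.mono Metric.ball_subset_closedBall)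
    simpa using this
  have hh0 : ∀ x, ‖x‖ = R → h x = 0 := fun x hx => by simp [h, hs x hx]
  -- volume preserved for small times
  have key : ∀ t : ℝ, 0 < t → t < 1 → t * (C + 1) < 1 →
      ∫ x in B, (ContinuousLinearMap.id ℝ E + t • A x).det ∂μ = μ.real B ∧
      IntegrableOn (fun x => (ContinuousLinearMap.id ℝ E + t • A x).det) B μ := by
    intro t ht ht1 htC
    let f : E → E := fun x => x + t • h x
    have hdf : ∀ x ∈ B, HasFDerivWithinAt f (ContinuousLinearMap.id ℝ E + t • A x) B x :=
      fun x hx => ((hasFDerivAt_id x).add ((hdh x hx).const_smul t)).hasFDerivWithinAt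
    have hdist : ∀ x ∈ Metric.closedBall (0 : E) R, ∀ y ∈ Metric.closedBall (0 : E) R,
        ‖t • h x - t • h y‖ ≤ t * (C + 1) * ‖x - y‖ := by
      intro x hx y hy
      have h1 := hLh.dist_le_mul x hx y hy
      rw [dist_eq_norm, dist_eq_norm] at h1
      rw [← smul_sub, norm_smul, Real.norm_of_nonneg ht.le, mul_assoc]
      exact mul_le_mul_of_nonneg_left (by simpa using h1) ht.le
    have hinj : InjOn f (Metric.closedBall (0 : E) R) := by
      intro x hx y hy hxy
      have h1 : x - y = -(t • h x - t • h y) := by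
        have : x + t • h x = y + t • h y := hxy
        linear_combination (norm := module) this
      have h2 := hdist x hx y hy
      have h3 : ‖x - y‖ = ‖t • h x - t • h y‖ := by rw [h1, norm_neg]
      by_contra hne
      have h4 : 0 < ‖x - y‖ := norm_pos_iff.2 (sub_ne_zero.2 hne)
      nlinarith
    have hfs : ∀ x, ‖x‖ = R → f x = x := fun x hx => by simp [f, hh0 x hx]
    have hmaps : ∀ x ∈ B, f x ∈ B := by
      intro x hx
      have hx' : ‖x‖ < R := by simpa [B] using hx
      have h1 : f x = (1 - t) • x + t • K x := by simp only [f, h]; module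
      have h2 : ‖f x‖ ≤ (1 - t) * ‖x‖ + t * R := by
        rw [h1]
        refine (norm_add_le _ _).trans ?_
        rw [norm_smul, norm_smul, Real.norm_of_nonneg ht.le, Real.norm_of_nonneg (by linarith),
          hn x hx'.le]
      have : ‖f x‖ < R := by nlinarith
      simpa [B] using this
    have hcont : ContinuousOn f (Metric.closedBall (0 : E) R) :=
      continuousOn_id.add (hLh.continuousOn.const_smul t)
    have hopen : IsOpen (f '' B) := by
      have happ : ApproximatesLinearOn f (ContinuousLinearMap.id ℝ E) B
          (⟨t * (C + 1), by positivity⟩ : NNReal) := by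
        intro x hx y hy
        have := hdist x (Metric.ball_subset_closedBall hx) y (Metric.ball_subset_closedBall hy)
        have h1 : f x - f y - (ContinuousLinearMap.id ℝ E) (x - y) = t • h x - t • h y := by
          simp only [f, ContinuousLinearMap.id_apply]; abel
        rw [h1]; exact this
      refine happ.open_image ⟨id, 1, fun y => by simp, fun y => rfl⟩ Metric.isOpen_ball (Or.inr ?_)
      rw [inv_one]
      exact_mod_cast htC
    have himg : f '' B = B := by
      refine Subset.antisymm (by rintro _ ⟨x, hx, rfl⟩; exact hmaps x hx) ?_
      refine (convex_ball (0 : E) R).isPreconnected.subset_of_closure_inter_subset hopen ?_ ?_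
      · have h0 : (0 : E) ∈ B := by simpa [B] using hR
        exact ⟨f 0, hmaps 0 h0, mem_image_of_mem f h0⟩
      · rintro y ⟨hy, hyB⟩
        have hclosed : IsClosed (f '' Metric.closedBall (0 : E) R) :=
          ((isCompact_closedBall (0 : E) R).image_of_continuousOn hcont).isClosed
        have hsub : closure (f '' B) ⊆ f '' Metric.closedBall (0 : E) R :=
          closure_minimal (image_mono Metric.ball_subset_closedBall) hclosed
        obtain ⟨x, hx, rfl⟩ := hsub hy
        refine mem_image_of_mem f ?_
        have hx' : ‖x‖ ≤ R := by simpa using hx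
        have hlt : ‖x‖ < R := by
          refine lt_of_le_of_ne hx' fun he => ?_
          rw [hfs x he] at hyB
          have : ‖x‖ < R := by simpa [B] using hyB
          linarith
        simpa [B] using hlt
    have hinjB : InjOn f B := hinj.mono Metric.ball_subset_closedBall
    have hcv := integral_image_eq_integral_abs_det_fderiv_smul μ Metric.isOpen_ball.measurableSet
      hdf hinjB (fun _ => (1 : ℝ))
    have hci := (integrableOn_image_iff_integrableOn_abs_det_fderiv_smul μ
      Metric.isOpen_ball.measurableSet hdf hinjB (fun _ => (1 : ℝ))).1 (by
        rw [himg]; exact integrableOn_const (measure_ball_lt_top.ne))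
    have hpos : ∀ x ∈ B, |(ContinuousLinearMap.id ℝ E + t • A x).det| • (1 : ℝ) =
        (ContinuousLinearMap.id ℝ E + t • A x).det := by
      intro x hx
      have : t * ‖A x‖ < 1 := lt_of_le_of_lt (mul_le_mul_of_nonneg_left (hAn x hx) ht.le) htC
      rw [abs_of_pos (det_id_add_smul_pos _ ht.le this), smul_eq_mul, mul_one]
    refine ⟨?_, hci.congr_fun hpos Metric.isOpen_ball.measurableSet⟩
    rw [← setIntegral_congr_fun Metric.isOpen_ball.measurableSet hpos, ← hcv, himg]
    simp [Measure.real]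
  -- the determinant vanishes at time one
  have hzero : ∀ x ∈ B, (ContinuousLinearMap.id ℝ E + (1 : ℝ) • A x).det = 0 := by
    intro x hx
    have hx' : ‖x‖ < R := by simpa [B] using hx
    have hKd : HasFDerivAt K (ContinuousLinearMap.id ℝ E + (1 : ℝ) • A x) x := by
      have := (hasFDerivAt_id x).add ((hdh x hx).const_smul (1 : ℝ))
      refine this.congr_of_eventuallyEq (Eventually.of_forall fun y => ?_)
      simp [h]
    have hconst : (fun y => inner ℝ (K y) (K y)) =ᶠ[𝓝 x] fun _ => R ^ 2 := by
      filter_upwards [Metric.isOpen_ball.mem_nhds hx] with y hy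
      have hy' : ‖y‖ < R := by simpa using hy
      rw [real_inner_self_eq_norm_sq, hn y hy'.le]
    have hder := (hKd.inner ℝ hKd).unique
      ((hasFDerivAt_const (R ^ 2) x).congr_of_eventuallyEq hconst)
    by_contra hdet
    have hsurj : Function.Surjective (ContinuousLinearMap.id ℝ E + (1 : ℝ) • A x) :=
      (LinearMap.equivOfDetNeZero _ hdet).surjective
    obtain ⟨v, hv⟩ := hsurj (K x)
    have h1 := congrArg (fun L : E →L[ℝ] ℝ => L v) hder
    simp only [ContinuousLinearMap.comp_apply, ContinuousLinearMap.prod_apply,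
      fderivInnerCLM_apply, zero_apply, hv] at h1
    rw [real_inner_self_eq_norm_sq, hn x hx'.le] at h1
    nlinarith
  -- interpolate
  let d := Module.finrank ℝ E
  let δ : ℝ := 1 / (2 * (C + 1))
  have hC0 : (0 : ℝ) ≤ C := C.2
  have hδ0 : 0 < δ := by positivity
  let v : ℕ → ℝ := fun j => δ / (j + 1)
  have hv0 : ∀ j, 0 < v j := fun j => by positivity
  have hvle : ∀ j, v j ≤ δ := fun j => by
    refine div_le_self hδ0.le ?_
    have : (0 : ℝ) ≤ j := Nat.cast_nonneg j
    linarith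
  have hδ1 : δ * (C + 1) < 1 := by
    have : δ * (C + 1) = 1 / 2 := by simp only [δ]; field_simp
    linarith
  have hδlt : δ < 1 := by nlinarith
  have hkey : ∀ j, _ := fun j => key (v j) (hv0 j) ((hvle j).trans_lt hδlt)
    ((mul_le_mul_of_nonneg_right (hvle j) (by positivity)).trans_lt hδ1)
  have hinjv : InjOn v (Finset.range (d + 1) : Set ℕ) := by
    intro i _ j _ hij
    have : (i : ℝ) + 1 = j + 1 := by
      have h1 : δ / ((i : ℝ) + 1) = δ / (j + 1) := hij
      field_simp at h1
      linarith
    exact_mod_cast add_right_cancel this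
  let L : ℕ → ℝ := fun j => (Lagrange.basis (Finset.range (d + 1)) v j).eval 1
  have hLsum : ∑ j ∈ Finset.range (d + 1), L j = 1 := by
    have := congrArg (Polynomial.eval 1)
      (Lagrange.sum_basis hinjv (Finset.nonempty_range_iff.2 (Nat.succ_ne_zero d)))
    simpa [Polynomial.eval_finsetSum, L] using this
  have hinterp : ∀ x ∈ B, ∑ j ∈ Finset.range (d + 1),
      L j * (ContinuousLinearMap.id ℝ E + v j • A x).det = 0 := by
    intro x hx
    obtain ⟨P, hdeg, hP⟩ := exists_polynomial_det_id_add_smul (A x)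
    have := congrArg (Polynomial.eval 1) (Lagrange.eq_interpolate hinjv
      (by rw [Finset.card_range]; exact hdeg))
    rw [hP, hzero x hx, Lagrange.interpolate_apply, Polynomial.eval_finsetSum] at this
    rw [this]
    refine Finset.sum_congr rfl fun j _ => ?_
    simp [hP, L, mul_comm]
  have hfin : ∑ j ∈ Finset.range (d + 1), L j * μ.real B = 0 := by
    have h1 : ∫ x in B, ∑ j ∈ Finset.range (d + 1),
        L j * (ContinuousLinearMap.id ℝ E + v j • A x).det ∂μ = 0 := by
      rw [setIntegral_congr_fun Metric.isOpen_ball.measurableSet hinterp]; simp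
    rw [integral_finsetSum _ fun j _ => (hkey j).2.const_mul _] at h1
    rw [← h1]
    refine Finset.sum_congr rfl fun j _ => ?_
    rw [integral_const_mul, (hkey j).1]
  rw [← Finset.sum_mul, hLsum, one_mul] at hfin
  exact (Metric.isOpen_ball.measure_pos μ ⟨0, by simpa using hR⟩).ne'
    ((measureReal_eq_zero_iff measure_ball_lt_top.ne).1 hfin)

lemma exists_eq_smul_of_contDiff {E : Type*} [NormedAddCommGroup E] [InnerProductSpace ℝ E]
    [FiniteDimensional ℝ E] {p : E → E} (hp : ContDiff ℝ 1 p) {R : ℝ} (hR : 0 < R) :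
    ∃ x, ‖x‖ ≤ R ∧ x = (1 - ‖x‖ ^ 2 / R ^ 2) • p x := by
  by_contra! hcon
  let F : E → E := fun x => x - (1 - ‖x‖ ^ 2 / R ^ 2) • p x
  have hF : ContDiff ℝ 1 F :=
    contDiff_id.sub ((contDiff_const.sub ((contDiff_norm_sq ℝ).div_const _)).smul hp)
  have hF0 : ∀ x, ‖x‖ ≤ R → F x ≠ 0 := fun x hx h => hcon x hx (sub_eq_zero.1 h)
  let K : E → E := fun x => (R / ‖F x‖) • F x
  have hK : ∀ x, ‖x‖ ≤ R → ContDiffAt ℝ 1 K x := fun x hx =>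
    (contDiffAt_const.div (hF.contDiffAt.norm ℝ (hF0 x hx))
      (norm_ne_zero_iff.2 (hF0 x hx))).smul hF.contDiffAt
  have hKon : ContDiffOn ℝ 1 K (Metric.closedBall 0 R) := fun x hx =>
    (hK x (by simpa using hx)).contDiffWithinAt
  obtain ⟨C, hC⟩ := hKon.exists_lipschitzOnWith one_ne_zero (convex_closedBall _ _)
    (isCompact_closedBall _ _)
  refine no_lipschitz_retraction hR K (fun x hx => ?_) hC (fun x hx => ?_) (fun x hx => ?_)
  · exact (hK x (by simpa using (Metric.ball_subset_closedBall hx))).differentiableAt one_ne_zero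
  · have h1 : F x = x := by simp [F, hx, hR.ne']
    simp [K, h1, hx, hR.ne']
  · have := norm_ne_zero_iff.2 (hF0 x hx)
    simp only [K]
    rw [norm_smul, norm_div, norm_norm, Real.norm_of_nonneg hR.le, div_mul_cancel₀ _ this]

/-- **Brouwer's fixed point theorem**, for bounded continuous self-maps of a Euclidean space. -/
lemma exists_fixedPoint_of_bounded {E : Type*} [NormedAddCommGroup E] [InnerProductSpace ℝ E]
    [FiniteDimensional ℝ E] {f : E → E} (hf : Continuous f) {M : ℝ} (hM : ∀ x, ‖f x‖ ≤ M) :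
    ∃ x, f x = x := by
  have hM0 : 0 ≤ M := (norm_nonneg _).trans (hM 0)
  obtain ⟨x₀, -, hx₀⟩ := (isCompact_closedBall (0 : E) (M + 1)).exists_isMinOn
    ⟨0, by simp; linarith⟩ ((hf.sub continuous_id).norm.continuousOn)
  refine ⟨x₀, ?_⟩
  by_contra hne
  have hm : 0 < ‖f x₀ - x₀‖ := norm_pos_iff.2 (sub_ne_zero.2 hne)
  set m := ‖f x₀ - x₀‖ with hmdef
  obtain ⟨p, hp, hpd, -⟩ := hf.exists_contDiff_approx (ε := fun _ => min 1 (m / 2)) 1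
    continuous_const (fun _ => by positivity)
  let R : ℝ := 1 + 4 * (M + 1) ^ 3 / m
  have hR1 : 1 ≤ R := by
    have : 0 ≤ 4 * (M + 1) ^ 3 / m := by positivity
    simp only [R]; linarith
  obtain ⟨x, hxR, hx⟩ := exists_eq_smul_of_contDiff (by exact_mod_cast hp)
    (lt_of_lt_of_le one_pos hR1)
  have hR0 : 0 < R := one_pos.trans_le hR1
  have hpx := hpd x
  rw [dist_eq_norm] at hpx
  have hp1 : ‖p x‖ ≤ M + 1 := by
    have h1 : ‖p x‖ ≤ ‖p x - f x‖ + ‖f x‖ := by simpa using norm_add_le (p x - f x) (f x)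
    linarith [hM x, min_le_left 1 (m / 2)]
  have hq0 : 0 ≤ ‖x‖ ^ 2 / R ^ 2 := by positivity
  have hq1 : ‖x‖ ^ 2 / R ^ 2 ≤ 1 := by
    rw [div_le_one (by positivity)]
    exact pow_le_pow_left₀ (norm_nonneg _) hxR 2
  have hxM : ‖x‖ ≤ M + 1 := by
    rw [hx, norm_smul, Real.norm_of_nonneg (by linarith)]
    nlinarith [norm_nonneg (p x)]
  have hsplit : f x - x = (f x - p x) + (‖x‖ ^ 2 / R ^ 2) • p x := by
    have h1 : f x - x = f x - (1 - ‖x‖ ^ 2 / R ^ 2) • p x := congrArg (f x - ·) hx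
    rw [h1]; module
  have hle : ‖f x - x‖ ≤ ‖p x - f x‖ + (M + 1) ^ 3 / R ^ 2 := by
    rw [hsplit]
    refine (norm_add_le _ _).trans ?_
    rw [norm_sub_rev, norm_smul, Real.norm_of_nonneg hq0]
    have h1 : ‖x‖ ^ 2 * ‖p x‖ ≤ (M + 1) ^ 2 * (M + 1) :=
      mul_le_mul (pow_le_pow_left₀ (norm_nonneg _) hxM 2) hp1 (norm_nonneg _) (by positivity)
    have h2 : ‖x‖ ^ 2 / R ^ 2 * ‖p x‖ ≤ (M + 1) ^ 3 / R ^ 2 := by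
      rw [div_mul_eq_mul_div]
      gcongr
      linarith
    linarith
  have hR2 : (M + 1) ^ 3 / R ^ 2 ≤ m / 4 := by
    rw [div_le_iff₀ (by positivity)]
    have h1 : (M + 1) ^ 3 ≤ m / 4 * R := by
      simp only [R]
      have : m / 4 * (1 + 4 * (M + 1) ^ 3 / m) = m / 4 + (M + 1) ^ 3 := by field_simp
      linarith
    have h2 : R ≤ R ^ 2 := by nlinarith
    nlinarith
  have hmin : m ≤ ‖f x - x‖ := hx₀ (show x ∈ Metric.closedBall (0 : E) (M + 1) by simpa using hxM)
  linarith [min_le_right 1 (m / 2)]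

lemma exists_retraction_stdSimplex (ι : Type*) [Fintype ι] [Nonempty ι] :
    ∃ r : (ι → ℝ) → stdSimplex ℝ ι, Continuous r ∧ ∀ a : stdSimplex ℝ ι, r a = a := by
  classical
  let i₀ : ι := Classical.arbitrary ι
  let s : (ι → ℝ) → ℝ := fun x => ∑ i, max (x i) 0
  let c : (ι → ℝ) → ι → ℝ := fun x i =>
    (max (x i) 0 + (if i = i₀ then max (1 - s x) 0 else 0)) / max 1 (s x)
  have hs : Continuous s := continuous_finsetSum _ fun i _ =>
    (continuous_apply i).max continuous_const
  have hpos : ∀ x, 0 < max 1 (s x) := fun x => lt_max_of_lt_left one_pos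
  have hc : Continuous c := by
    refine continuous_pi fun i => ?_
    refine Continuous.div ?_ (continuous_const.max hs) fun x => (hpos x).ne'
    refine ((continuous_apply i).max continuous_const).add ?_
    by_cases h : i = i₀
    · simpa [h] using (continuous_const.sub hs).max continuous_const
    · simpa [h] using continuous_const
  have hmem : ∀ x, c x ∈ stdSimplex ℝ ι := by
    intro x
    refine ⟨fun i => div_nonneg (add_nonneg (le_max_right _ _) ?_) (hpos x).le, ?_⟩
    · split_ifs
      · exact le_max_right _ _
      · exact le_rfl
    · simp only [c]
      rw [← Finset.sum_div, div_eq_one_iff_eq (hpos x).ne', Finset.sum_add_distrib]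
      simp only [Finset.sum_ite_eq', Finset.mem_univ, if_true]
      change s x + _ = _
      rcases le_total (s x) 1 with h | h
      · rw [max_eq_left (by linarith), max_eq_left h]; ring
      · rw [max_eq_right (by linarith), max_eq_right h]; ring
  refine ⟨fun x => ⟨c x, hmem x⟩, hc.subtype_mk _, fun a => Subtype.ext ?_⟩
  have hsa : s a = 1 := by
    rw [← a.2.2]
    exact Finset.sum_congr rfl fun i _ => max_eq_left (a.2.1 i)
  funext i
  change c a i = _
  simp only [c, hsa]
  have h1 : max (a i) 0 = a i := max_eq_left (a.2.1 i)
  simp only [h1, sub_self, max_self, ite_self, add_zero, div_one]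
  rfl

/-- A complementarity form of Brouwer's theorem on the standard simplex. -/
lemma exists_forall_nonpos_of_sum_mul_eq_zero {ι : Type*} [Fintype ι] [Nonempty ι]
    (φ : ι → stdSimplex ℝ ι → ℝ) (hφ : ∀ k, Continuous (φ k))
    (h0 : ∀ a : stdSimplex ℝ ι, ∑ k, a.1 k * φ k a = 0) :
    ∃ a, ∀ k, φ k a ≤ 0 := by
  obtain ⟨r, hr, hra⟩ := exists_retraction_stdSimplex ι
  let S : stdSimplex ℝ ι → ℝ := fun a => ∑ k, max (φ k a) 0
  have hS : Continuous S := continuous_finsetSum _ fun k _ => (hφ k).max continuous_const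
  have hS0 : ∀ a, 0 ≤ S a := fun a => Finset.sum_nonneg fun k _ => le_max_right _ _
  let N : stdSimplex ℝ ι → ι → ℝ := fun a k => (a.1 k + max (φ k a) 0) / (1 + S a)
  have hpos : ∀ a, 0 < 1 + S a := fun a => by linarith [hS0 a]
  have hN : Continuous N := continuous_pi fun k =>
    (((continuous_apply k).comp continuous_subtype_val).add ((hφ k).max continuous_const)).div
      (continuous_const.add hS) fun a => (hpos a).ne'
  have hNmem : ∀ a, N a ∈ stdSimplex ℝ ι := by
    intro a
    refine ⟨fun k => div_nonneg (add_nonneg (a.2.1 k) (le_max_right _ _)) (hpos a).le, ?_⟩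
    simp only [N]
    rw [← Finset.sum_div, div_eq_one_iff_eq (hpos a).ne', Finset.sum_add_distrib, a.2.2]
  let f : EuclideanSpace ℝ ι → EuclideanSpace ℝ ι := fun x => WithLp.toLp 2 (N (r x.ofLp))
  have hf : Continuous f :=
    (PiLp.continuous_toLp 2 _).comp (hN.comp (hr.comp (PiLp.continuous_ofLp 2 _)))
  obtain ⟨M, hM⟩ := (isCompact_stdSimplex ℝ ι).exists_bound_of_continuousOn
    (PiLp.continuous_toLp 2 (fun _ : ι => ℝ)).continuousOn
  obtain ⟨x, hx⟩ := exists_fixedPoint_of_bounded hf (M := M) (fun x => hM _ (hNmem _))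
  have hxN : x.ofLp = N (r x.ofLp) := by
    conv_lhs => rw [← hx]
  have hxm : x.ofLp ∈ stdSimplex ℝ ι := by rw [hxN]; exact hNmem _
  let a : stdSimplex ℝ ι := ⟨x.ofLp, hxm⟩
  have haN : a.1 = N a := by
    have h1 : r x.ofLp = a := hra a
    rw [← h1]
    rw [h1]
    exact hxN.trans (by rw [h1])
  have hk : ∀ k, a.1 k * S a = max (φ k a) 0 := by
    intro k
    have h1 : a.1 k = (a.1 k + max (φ k a) 0) / (1 + S a) := congrFun haN k
    rw [eq_div_iff (hpos a).ne'] at h1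
    linarith
  refine ⟨a, ?_⟩
  rcases (hS0 a).eq_or_lt with h | h
  · intro k
    have := hk k
    rw [← h, mul_zero] at this
    exact this ▸ le_max_left _ _
  · exfalso
    have hterm : ∀ k ∈ Finset.univ, 0 ≤ a.1 k * φ k a := by
      intro k _
      rcases (a.2.1 k).eq_or_lt with h1 | h1
      · simp [← h1]
      · have h2 : 0 < max (φ k a) 0 := by rw [← hk k]; exact mul_pos h1 h
        rcases lt_max_iff.1 h2 with h3 | h3
        · exact (mul_pos h1 h3).le
        · exact absurd h3 (lt_irrefl _)
    have hz := (Finset.sum_eq_zero_iff_of_nonneg hterm).1 (h0 a)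
    have : ∀ k, a.1 k = 0 := by
      intro k
      by_contra hne
      have h1 : 0 < a.1 k := lt_of_le_of_ne (a.2.1 k) (Ne.symm hne)
      have h2 : 0 < max (φ k a) 0 := by rw [← hk k]; exact mul_pos h1 h
      rcases lt_max_iff.1 h2 with h3 | h3
      · exact (mul_pos h1 h3).ne' (hz k (Finset.mem_univ k))
      · exact absurd h3 (lt_irrefl _)
    have h1 := a.2.2
    simp [this] at h1

end Brouwer

section WeakConvergence

/-- Weak limits of products: if real functions `p j` with values in `[0, 1]` converge weakly in each
coordinate, then their tensor products converge weakly against integrable functions. -/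
lemma tendsto_integral_prod_mul_of_tendsto_setIntegral {ι α : Type*} [Fintype ι] {T : ι → Type*}
    [∀ i, MeasurableSpace (T i)] (μ : ∀ i, Measure (T i)) [∀ i, IsProbabilityMeasure (μ i)]
    {l : Filter α} {p : α → ∀ i, T i → ℝ} {p₀ : ∀ i, T i → ℝ}
    (hpm : ∀ a i, Measurable (p a i)) (hp : ∀ a i t, p a i t ∈ Icc (0 : ℝ) 1)
    (hpm₀ : ∀ i, Measurable (p₀ i)) (hp₀ : ∀ i t, p₀ i t ∈ Icc (0 : ℝ) 1)
    (hlim : ∀ i s, MeasurableSet s →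
      Tendsto (fun a => ∫ t in s, p a i t ∂μ i) l (𝓝 (∫ t in s, p₀ i t ∂μ i)))
    {w : (∀ i, T i) → ℝ} (hw : Integrable w (Measure.pi μ)) :
    Tendsto (fun a => ∫ t, (∏ i, p a i (t i)) * w t ∂Measure.pi μ) l
      (𝓝 (∫ t, (∏ i, p₀ i (t i)) * w t ∂Measure.pi μ)) := by
  have hmeas : ∀ r : ∀ i, T i → ℝ, (∀ i, Measurable (r i)) →
      Measurable fun t : ∀ i, T i => ∏ i, r i (t i) := fun r hr =>
    Finset.measurable_prod _ fun i _ => (hr i).comp (measurable_pi_apply i)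
  have hbd : ∀ r : ∀ i, T i → ℝ, (∀ i t, r i t ∈ Icc (0 : ℝ) 1) →
      ∀ t : ∀ i, T i, ‖∏ i, r i (t i)‖ ≤ 1 := by
    intro r hr t
    rw [Real.norm_of_nonneg (Finset.prod_nonneg fun i _ => (hr i _).1)]
    exact Finset.prod_le_one (fun i _ => (hr i _).1) fun i _ => (hr i _).2
  have hprod_int : ∀ r : ∀ i, T i → ℝ, (∀ i, Measurable (r i)) → (∀ i t, r i t ∈ Icc (0 : ℝ) 1) →
      ∀ {f : (∀ i, T i) → ℝ}, Integrable f (Measure.pi μ) →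
      Integrable (fun t => (∏ i, r i (t i)) * f t) (Measure.pi μ) := fun r hr hr1 f hf =>
    hf.bdd_mul (hmeas r hr).aestronglyMeasurable (Eventually.of_forall (hbd r hr1))
  have hint1 : ∀ r : ∀ i, T i → ℝ, (∀ i, Measurable (r i)) → (∀ i t, r i t ∈ Icc (0 : ℝ) 1) →
      Integrable (fun t : ∀ i, T i => ∏ i, r i (t i)) (Measure.pi μ) := fun r hr hr1 => by
    simpa using hprod_int r hr hr1 (integrable_const (1 : ℝ))
  -- rectangles
  have hrect : ∀ s : ∀ i, Set (T i), (∀ i, MeasurableSet (s i)) →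
      Tendsto (fun a => ∫ t in univ.pi s, ∏ i, p a i (t i) ∂Measure.pi μ) l
        (𝓝 (∫ t in univ.pi s, ∏ i, p₀ i (t i) ∂Measure.pi μ)) := by
    intro s hs
    have heq : ∀ r : ∀ i, T i → ℝ, ∫ t in univ.pi s, ∏ i, r i (t i) ∂Measure.pi μ
        = ∏ i, ∫ t in s i, r i t ∂μ i := by
      intro r
      rw [Measure.restrict_pi_pi]
      exact integral_fintype_prod_eq_prod r
    simp_rw [heq]
    exact tendsto_finsetProd _ fun i _ => hlim i _ (hs i)
  -- measurable sets
  have hset : ∀ A : Set (∀ i, T i), MeasurableSet A →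
      Tendsto (fun a => ∫ t in A, ∏ i, p a i (t i) ∂Measure.pi μ) l
        (𝓝 (∫ t in A, ∏ i, p₀ i (t i) ∂Measure.pi μ)) := by
    refine MeasurableSpace.induction_on_inter generateFrom_pi.symm isPiSystem_pi ?_ ?_ ?_ ?_
    · simpa using tendsto_const_nhds
    · rintro _ ⟨s, hs, rfl⟩
      exact hrect s fun i => hs i (mem_univ i)
    · intro A hA ih
      have hu := hrect (fun _ => univ) fun _ => MeasurableSet.univ
      have hsplit : ∀ r : ∀ i, T i → ℝ, (∀ i, Measurable (r i)) → (∀ i t, r i t ∈ Icc (0 : ℝ) 1) →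
          ∫ t in Aᶜ, ∏ i, r i (t i) ∂Measure.pi μ =
            ∫ t in univ.pi fun _ => univ, ∏ i, r i (t i) ∂Measure.pi μ
              - ∫ t in A, ∏ i, r i (t i) ∂Measure.pi μ := by
        intro r hr hr1
        rw [pi_univ, Measure.restrict_univ, ← integral_add_compl hA (hint1 r hr hr1)]
        ring
      simp_rw [fun a => hsplit (p a) (hpm a) (hp a), hsplit p₀ hpm₀ hp₀]
      exact hu.sub ih
    · intro f hd hfm ih
      have hU : ∀ r : ∀ i, T i → ℝ, (∀ i, Measurable (r i)) → (∀ i t, r i t ∈ Icc (0 : ℝ) 1) →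
          ∫ t in ⋃ n, f n, ∏ i, r i (t i) ∂Measure.pi μ =
            ∑' n, ∫ t in f n, ∏ i, r i (t i) ∂Measure.pi μ := fun r hr hr1 =>
        integral_iUnion hfm hd (hint1 r hr hr1).integrableOn
      simp_rw [fun a => hU (p a) (hpm a) (hp a), hU p₀ hpm₀ hp₀]
      refine tendsto_tsum_of_dominated_convergence (bound := fun n => (Measure.pi μ).real (f n))
        ?_ ih (Eventually.of_forall fun a n => ?_)
      · refine ENNReal.summable_toReal ?_
        rw [← measure_iUnion hd hfm]
        exact measure_ne_top _ _
      · refine (norm_setIntegral_le_of_norm_le_const (measure_lt_top _ _)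
          fun t _ => hbd (p a) (hp a) t).trans ?_
        rw [one_mul]
  -- integrable functions
  refine Integrable.induction (μ := Measure.pi μ) (fun w : (∀ i, T i) → ℝ =>
    Tendsto (fun a => ∫ t, (∏ i, p a i (t i)) * w t ∂Measure.pi μ) l
      (𝓝 (∫ t, (∏ i, p₀ i (t i)) * w t ∂Measure.pi μ))) ?_ ?_ ?_ ?_ hw
  · intro c A hA _
    have heq : ∀ r : ∀ i, T i → ℝ, ∫ t, (∏ i, r i (t i)) * A.indicator (fun _ => c) t ∂Measure.pi μ
        = (∫ t in A, ∏ i, r i (t i) ∂Measure.pi μ) * c := by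
      intro r
      rw [← integral_mul_const, ← integral_indicator hA]
      refine integral_congr_ae (Eventually.of_forall fun t => ?_)
      by_cases h : t ∈ A <;> simp [h]
    simp_rw [heq]
    exact (hset A hA).mul_const c
  · intro f g _ hf hg ihf ihg
    have heq : ∀ r : ∀ i, T i → ℝ, (∀ i, Measurable (r i)) → (∀ i t, r i t ∈ Icc (0 : ℝ) 1) →
        ∫ t, (∏ i, r i (t i)) * (f + g) t ∂Measure.pi μ =
          ∫ t, (∏ i, r i (t i)) * f t ∂Measure.pi μ + ∫ t, (∏ i, r i (t i)) * g t ∂Measure.pi μ := by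
      intro r hr hr1
      rw [← integral_add (hprod_int r hr hr1 hf) (hprod_int r hr hr1 hg)]
      simp [mul_add]
    simp_rw [fun a => heq (p a) (hpm a) (hp a), heq p₀ hpm₀ hp₀]
    exact ihf.add ihg
  · refine isClosed_of_closure_subset fun f hf => ?_
    have hdiff : ∀ r : ∀ i, T i → ℝ, (∀ i, Measurable (r i)) → (∀ i t, r i t ∈ Icc (0 : ℝ) 1) →
        ∀ g : (∀ i, T i) →₁[Measure.pi μ] ℝ,
        dist (∫ t, (∏ i, r i (t i)) * f t ∂Measure.pi μ)
          (∫ t, (∏ i, r i (t i)) * g t ∂Measure.pi μ) ≤ dist f g := by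
      intro r hr hr1 g
      rw [L1.dist_eq_integral_dist, dist_eq_norm,
        ← integral_sub (hprod_int r hr hr1 (L1.integrable_coeFn f))
          (hprod_int r hr hr1 (L1.integrable_coeFn g))]
      refine norm_integral_le_of_norm_le ?_ (Eventually.of_forall fun t => ?_)
      · have := ((L1.integrable_coeFn f).sub (L1.integrable_coeFn g)).norm
        simpa [dist_eq_norm] using this
      · rw [← mul_sub, norm_mul, dist_eq_norm]
        exact mul_le_of_le_one_left (norm_nonneg _) (hbd r hr1 t)
    rw [mem_ofPred_eq, Metric.tendsto_nhds]
    intro ε hε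
    obtain ⟨g, hg, hgd⟩ := Metric.mem_closure_iff.1 hf (ε / 3) (by positivity)
    filter_upwards [Metric.tendsto_nhds.1 hg (ε / 3) (by positivity)] with a ha
    have h1 := hdiff (p a) (hpm a) (hp a) g
    have h2 := hdiff p₀ hpm₀ hp₀ g
    rw [dist_comm] at h2
    refine lt_of_le_of_lt (dist_triangle4 _ (∫ t, (∏ i, p a i (t i)) * g t ∂Measure.pi μ)
      (∫ t, (∏ i, p₀ i (t i)) * g t ∂Measure.pi μ) _) ?_
    linarith
  · intro f g hfg _ ih
    have heq : ∀ r : ∀ i, T i → ℝ, ∫ t, (∏ i, r i (t i)) * g t ∂Measure.pi μ =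
        ∫ t, (∏ i, r i (t i)) * f t ∂Measure.pi μ := fun r =>
      integral_congr_ae (by filter_upwards [hfg] with t ht; rw [ht])
    simp_rw [heq]
    exact ih

/-- Weak compactness of the set of measurable functions with values in `[0, 1]`. -/
lemma exists_tendsto_setIntegral_of_ultrafilter {α T : Type*} [MeasurableSpace T] (μ : Measure T)
    [IsProbabilityMeasure μ] (l : Ultrafilter α) {p : α → T → ℝ} (hpm : ∀ a, Measurable (p a))
    (hp : ∀ a t, p a t ∈ Icc (0 : ℝ) 1) :
    ∃ p₀ : T → ℝ, Measurable p₀ ∧ (∀ t, p₀ t ∈ Icc (0 : ℝ) 1) ∧ ∀ s, MeasurableSet s →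
      Tendsto (fun a => ∫ t in s, p a t ∂μ) l (𝓝 (∫ t in s, p₀ t ∂μ)) := by
  have hbd : ∀ a t, ‖p a t‖ ≤ 1 := fun a t => by
    rw [Real.norm_of_nonneg (hp a t).1]; exact (hp a t).2
  have hLp : ∀ a, MemLp (p a) 2 μ := fun a =>
    MemLp.of_bound (hpm a).aestronglyMeasurable 1 (Eventually.of_forall (hbd a))
  let D : Lp ℝ 2 μ ≃ₗᵢ[ℝ] StrongDual ℝ (Lp ℝ 2 μ) := InnerProductSpace.toDual ℝ (Lp ℝ 2 μ)
  let F : α → WeakDual ℝ (Lp ℝ 2 μ) := fun a => StrongDual.toWeakDual (D (hLp a).toLp)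
  have hF : ∀ a, F a ∈ WeakDual.toStrongDual ⁻¹'
      Metric.closedBall (0 : StrongDual ℝ (Lp ℝ 2 μ)) 1 := by
    intro a
    have h1 : WeakDual.toStrongDual (F a) = D (hLp a).toLp := rfl
    rw [mem_preimage, h1, mem_closedBall_zero_iff, LinearIsometryEquiv.norm_map]
    refine (Lp.norm_le_of_ae_bound zero_le_one ?_).trans_eq (by simp [measureUnivNNReal])
    filter_upwards [(hLp a).coeFn_toLp] with t ht
    rw [ht]; exact hbd a t
  obtain ⟨L, -, hL⟩ := (WeakDual.isCompact_closedBall (0 : StrongDual ℝ (Lp ℝ 2 μ))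
    1).ultrafilter_le_nhds (l.map F) (by
      rw [le_principal_iff, Ultrafilter.mem_coe, Ultrafilter.mem_map]
      exact Filter.univ_mem' hF)
  let q : Lp ℝ 2 μ := D.symm (WeakDual.toStrongDual L)
  have hq : ∀ s, MeasurableSet s →
      Tendsto (fun a => ∫ t in s, p a t ∂μ) l (𝓝 (∫ t in s, q t ∂μ)) := by
    intro s hs
    have hLt : Tendsto F l (𝓝 L) := hL
    let v : Lp ℝ 2 μ := indicatorConstLp 2 hs (measure_ne_top μ s) (1 : ℝ)
    have h1 : Tendsto (fun a => F a v) l (𝓝 (L v)) :=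
      ((WeakDual.eval_continuous v).tendsto L).comp hLt
    have h2 : ∀ r : Lp ℝ 2 μ, D r v = ∫ t in s, r t ∂μ := by
      intro r
      rw [InnerProductSpace.toDual_apply_apply, real_inner_comm]
      exact L2.inner_indicatorConstLp_one hs (measure_ne_top μ s) r
    have h3 : ∀ a, F a v = ∫ t in s, p a t ∂μ := by
      intro a
      refine (h2 _).trans (setIntegral_congr_ae hs ?_)
      filter_upwards [(hLp a).coeFn_toLp] with t ht _ using ht
    have h4 : L v = ∫ t in s, q t ∂μ := by
      rw [← h2]; simp [q]
    rw [← h4]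
    simpa [h3] using h1
  have hqi : Integrable q μ := (Lp.memLp q).integrable (by norm_num)
  have hpi : ∀ a, Integrable (p a) μ := fun a => (hLp a).integrable (by norm_num)
  have hq0 : 0 ≤ᵐ[μ] q := by
    refine ae_nonneg_of_forall_setIntegral_nonneg hqi fun s hs _ => ?_
    exact ge_of_tendsto' (hq s hs) fun a => setIntegral_nonneg hs fun t _ => (hp a t).1
  have hq1 : q ≤ᵐ[μ] fun _ => (1 : ℝ) := by
    refine ae_le_of_forall_setIntegral_le hqi (integrable_const _) fun s hs _ => ?_
    exact le_of_tendsto' (hq s hs) fun a =>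
      setIntegral_mono (hpi a).integrableOn (integrable_const _).integrableOn fun t => (hp a t).2
  have hqm : Measurable q := (Lp.stronglyMeasurable q).measurable
  refine ⟨fun t => max 0 (min 1 (q t)), measurable_const.max (measurable_const.min hqm),
    fun t => ⟨le_max_left _ _, max_le zero_le_one (min_le_left _ _)⟩, fun s hs => ?_⟩
  have : ∫ t in s, max 0 (min 1 (q t)) ∂μ = ∫ t in s, q t ∂μ := by
    refine setIntegral_congr_ae hs ?_
    filter_upwards [hq0, hq1] with t h0 h1 _
    rw [min_eq_right h1]; exact max_eq_right h0
  rw [this]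
  exact hq s hs

end WeakConvergence

section Purification

/-- A behavioral strategy: a measurable assignment of a probability vector over actions. -/
def IsBehavioral {A B : Type*} [MeasurableSpace A] [Fintype B] (g : A → B → ℝ) : Prop :=
  (∀ b, Measurable fun a => g a b) ∧ ∀ a, g a ∈ stdSimplex ℝ B

/-- Weak convergence of behavioral strategies, tested on measurable sets. -/
def WeakTendsto {α A B : Type*} [MeasurableSpace A] (μ : Measure A) (G : α → A → B → ℝ)
    (l : Filter α) (g : A → B → ℝ) : Prop :=
  ∀ b s, MeasurableSet s →
    Tendsto (fun k => ∫ a in s, G k a b ∂μ) l (𝓝 (∫ a in s, g a b ∂μ))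

open Classical in
/-- The behavioral strategy that plays the pure strategy `f`. -/
def diracStrategy {A B : Type*} (f : A → B) (a : A) (b : B) : ℝ := if f a = b then 1 else 0

lemma IsBehavioral.mem_Icc {A B : Type*} [MeasurableSpace A] [Fintype B] {g : A → B → ℝ}
    (hg : IsBehavioral g) (a : A) (b : B) : g a b ∈ Icc (0 : ℝ) 1 :=
  ⟨(hg.2 a).1 b, (hg.2 a).2 ▸
    Finset.single_le_sum (fun c _ => (hg.2 a).1 c) (Finset.mem_univ b)⟩

lemma IsBehavioral.integrable {A B : Type*} [MeasurableSpace A] [Fintype B] {g : A → B → ℝ}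
    (hg : IsBehavioral g) (μ : Measure A) [IsFiniteMeasure μ] (b : B) :
    Integrable (fun a => g a b) μ :=
  Integrable.of_bound (hg.1 b).aestronglyMeasurable 1 (Eventually.of_forall fun a => by
    rw [Real.norm_of_nonneg (hg.mem_Icc a b).1]; exact (hg.mem_Icc a b).2)

lemma isBehavioral_diracStrategy {A B : Type*} [MeasurableSpace A] [Fintype B] {f : A → B}
    (hf : IsPureStrategy f) : IsBehavioral (diracStrategy f) := by
  classical
  refine ⟨fun b => ?_, fun a => ⟨fun b => ?_, ?_⟩⟩
  · exact Measurable.ite (hf b) measurable_const measurable_const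
  · unfold diracStrategy; split_ifs <;> norm_num
  · simp [diracStrategy]

lemma exists_weakTendsto_of_ultrafilter {α A B : Type*} [MeasurableSpace A] [Fintype B]
    [Nonempty B] (μ : Measure A) [IsProbabilityMeasure μ] (l : Ultrafilter α)
    {G : α → A → B → ℝ} (hG : ∀ k, IsBehavioral (G k)) :
    ∃ g, IsBehavioral g ∧ WeakTendsto μ G l g := by
  classical
  choose p hpm hp01 hp using fun b => exists_tendsto_setIntegral_of_ultrafilter μ l
    (fun k => (hG k).1 b) (fun k a => (hG k).mem_Icc a b)
  have hpi : ∀ b, Integrable (p b) μ := fun b =>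
    Integrable.of_bound (hpm b).aestronglyMeasurable 1 (Eventually.of_forall fun a => by
      rw [Real.norm_of_nonneg (hp01 b a).1]; exact (hp01 b a).2)
  have hsum : (fun a => ∑ b, p b a) =ᵐ[μ] fun _ => (1 : ℝ) := by
    refine Integrable.ae_eq_of_forall_setIntegral_eq _ _
      (integrable_finsetSum _ fun b _ => hpi b) (integrable_const _) fun s hs _ => ?_
    rw [integral_finsetSum _ fun b _ => (hpi b).integrableOn]
    have h1 := tendsto_finsetSum Finset.univ fun b _ => hp b s hs
    refine tendsto_nhds_unique h1 (tendsto_const_nhds.congr fun k => ?_)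
    rw [← integral_finsetSum _ fun b _ => ((hG k).integrable μ b).integrableOn]
    exact setIntegral_congr_fun hs fun a _ => ((hG k).2 a).2.symm
  have hms : MeasurableSet {a | ∑ b, p b a = 1} :=
    (Finset.measurable_sum _ fun b _ => hpm b) (measurableSet_singleton 1)
  let b₀ : B := Classical.arbitrary B
  refine ⟨fun a b => if ∑ c, p c a = 1 then p b a else if b = b₀ then 1 else 0, ⟨fun b => ?_,
    fun a => ?_⟩, fun b s hs => ?_⟩
  · exact Measurable.ite hms (hpm b) measurable_const
  · by_cases h : ∑ c, p c a = 1
    · simp only [h, if_true]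
      exact ⟨fun b => (hp01 b a).1, h⟩
    · simp only [h, if_false]
      refine ⟨fun b => ?_, by simp⟩
      dsimp only
      split_ifs <;> norm_num
  · have : ∫ a in s, (if ∑ c, p c a = 1 then p b a else if b = b₀ then 1 else 0) ∂μ
        = ∫ a in s, p b a ∂μ := by
      refine setIntegral_congr_ae hs ?_
      filter_upwards [hsum] with a ha _
      simp [ha]
    rw [this]
    exact hp b s hs

/-- Functions with vanishing integral over all sets of a sub-σ-algebra are orthogonal to the
integrable functions measurable with respect to it. -/
lemma integral_mul_eq_zero_of_forall_setIntegral_eq_zero {A : Type*} {G mA : MeasurableSpace A}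
    (μ : Measure A) [IsFiniteMeasure μ] (hG : G ≤ mA) {k w : A → ℝ} (hk : Measurable k) {C : ℝ}
    (hkC : ∀ a, ‖k a‖ ≤ C) (h0 : ∀ s, MeasurableSet[G] s → ∫ a in s, k a ∂μ = 0)
    (hw : Measurable[G] w) (hwi : Integrable w μ) : ∫ a, w a * k a ∂μ = 0 := by
  have hki : Integrable k μ :=
    Integrable.of_bound hk.aestronglyMeasurable C (Eventually.of_forall hkC)
  have hwk : Integrable (w * k) μ := by
    have := hwi.bdd_mul hk.aestronglyMeasurable (Eventually.of_forall hkC)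
    refine this.congr (Eventually.of_forall fun a => ?_)
    simp [mul_comm]
  have hc : (0 : A → ℝ) =ᵐ[μ] μ[k|G] := by
    refine ae_eq_condExp_of_forall_setIntegral_eq hG hki (fun s _ _ => integrableOn_zero)
      (fun s hs _ => ?_) aestronglyMeasurable_zero
    rw [h0 s hs]; simp
  have hm := condExp_mul_of_stronglyMeasurable_left hw.stronglyMeasurable hwk hki
  change ∫ a, (w * k) a ∂μ = 0
  rw [← integral_condExp hG (f := w * k), integral_congr_ae hm]
  refine integral_eq_zero_of_ae ?_
  filter_upwards [hc] with a ha
  simp [← ha]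

/-- A set of positive measure that is not a conditional atom carries a nontrivial bounded function
whose integral vanishes over every set of the sub-σ-algebra. -/
lemma exists_perturbation_of_not_isCondAtom {A : Type*} {G mA : MeasurableSpace A}
    (μ : Measure A) [IsFiniteMeasure μ] (hG : G ≤ mA) {D : Set A} (hD : MeasurableSet D)
    (hD0 : 0 < μ D) (hna : ¬ IsCondAtom mA G μ D) :
    ∃ φ : A → ℝ, Measurable φ ∧ (∀ a, |φ a| ≤ 1) ∧ (∀ a, a ∉ D → φ a = 0) ∧
      (∀ s, MeasurableSet[G] s → ∫ a in s, φ a ∂μ = 0) ∧ ¬ φ =ᵐ[μ] 0 := by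
  have hex : ∃ D₀, MeasurableSet D₀ ∧ D₀ ⊆ D ∧
      ∀ D₁, MeasurableSet[G] D₁ → μ (symmDiff D₀ (D₁ ∩ D)) ≠ 0 := by
    by_contra! hcon
    exact hna ⟨hD, hD0, hcon⟩
  obtain ⟨D₀, hD₀, hsub, hne⟩ := hex
  -- clipped versions of the conditional probabilities
  have hcp : ∀ S : Set A, MeasurableSet S → ∃ p : A → ℝ, Measurable[G] p ∧
      (∀ a, p a ∈ Icc (0 : ℝ) 1) ∧
      ∀ s, MeasurableSet[G] s → ∫ a in s, (p a - S.indicator 1 a) ∂μ = 0 := by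
    intro S hS
    have hSi : Integrable (S.indicator (1 : A → ℝ)) μ := (integrable_const (1 : ℝ)).indicator hS
    have hm : Measurable[G] (μ[S.indicator (1 : A → ℝ)|G]) := stronglyMeasurable_condExp.measurable
    have h0 : 0 ≤ᵐ[μ] μ[S.indicator (1 : A → ℝ)|G] :=
      condExp_nonneg (Eventually.of_forall fun a => indicator_nonneg (fun _ _ => zero_le_one) a)
    have h1 : μ[S.indicator (1 : A → ℝ)|G] ≤ᵐ[μ] fun _ => (1 : ℝ) := by
      have := condExp_mono (m := G) hSi (integrable_const (1 : ℝ)) (Eventually.of_forall fun a =>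
        indicator_le_self' (f := (1 : A → ℝ)) (fun _ _ => zero_le_one) a)
      rwa [condExp_const hG] at this
    refine ⟨fun a => max 0 (min 1 (μ[S.indicator (1 : A → ℝ)|G] a)),
      measurable_const.max (measurable_const.min hm),
      fun t => ⟨le_max_left _ _, max_le zero_le_one (min_le_left _ _)⟩, fun s hs => ?_⟩
    have h2 : ∫ a in s, (max 0 (min 1 (μ[S.indicator (1 : A → ℝ)|G] a)) - S.indicator 1 a) ∂μ =
        ∫ a in s, (μ[S.indicator (1 : A → ℝ)|G] a - S.indicator 1 a) ∂μ := by
      refine setIntegral_congr_ae (hG s hs) ?_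
      filter_upwards [h0, h1] with a ha0 ha1 _
      have ha0' : 0 ≤ μ[S.indicator (1 : A → ℝ)|G] a := ha0
      rw [min_eq_right ha1, max_eq_right ha0']
    rw [h2, integral_sub integrable_condExp.integrableOn hSi.integrableOn,
      setIntegral_condExp hG hSi hs, sub_self]
  obtain ⟨p, hpm, hp01, hp⟩ := hcp D hD
  obtain ⟨p₀, hpm₀, hp01₀, hp₀⟩ := hcp D₀ hD₀
  have hpm' := hpm.mono hG le_rfl
  have hpm₀' := hpm₀.mono hG le_rfl
  have hindm : ∀ {S : Set A}, MeasurableSet S → Measurable (S.indicator (1 : A → ℝ)) :=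
    fun hS => measurable_one.indicator hS
  have hind01 : ∀ (S : Set A) a, S.indicator (1 : A → ℝ) a ∈ Icc (0 : ℝ) 1 := by
    intro S a
    by_cases h : a ∈ S <;> simp [h]
  have habs : ∀ {x y : ℝ}, x ∈ Icc (0 : ℝ) 1 → y ∈ Icc (0 : ℝ) 1 → |x - y| ≤ 1 := by
    intro x y hx hy
    rw [abs_le]; constructor <;> linarith [hx.1, hx.2, hy.1, hy.2]
  have hmul : ∀ {x y : ℝ}, x ∈ Icc (0 : ℝ) 1 → y ∈ Icc (0 : ℝ) 1 → x * y ∈ Icc (0 : ℝ) 1 :=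
    fun hx hy => ⟨mul_nonneg hx.1 hy.1, mul_le_one₀ hx.2 hy.1 hy.2⟩
  have horth : ∀ {S : Set A} {r v : A → ℝ}, MeasurableSet S → Measurable[G] r →
      (∀ a, r a ∈ Icc (0 : ℝ) 1) →
      (∀ s, MeasurableSet[G] s → ∫ a in s, (r a - S.indicator 1 a) ∂μ = 0) →
      Measurable[G] v → (∀ a, v a ∈ Icc (0 : ℝ) 1) →
      ∫ a, v a * (r a - S.indicator 1 a) ∂μ = 0 := by
    intro S r v hS hr hr01 hr0 hv hv01
    refine integral_mul_eq_zero_of_forall_setIntegral_eq_zero μ hG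
      ((hr.mono hG le_rfl).sub (hindm hS)) (C := 1) (fun a => habs (hr01 a) (hind01 S a)) hr0 hv ?_
    exact Integrable.of_bound (hv.mono hG le_rfl).aestronglyMeasurable 1
      (Eventually.of_forall fun a => by
        rw [Real.norm_of_nonneg (hv01 a).1]; exact (hv01 a).2)
  refine ⟨fun a => D₀.indicator 1 a * p a - D.indicator 1 a * p₀ a,
    ((hindm hD₀).mul hpm').sub ((hindm hD).mul hpm₀'),
    fun a => habs (hmul (hind01 _ a) (hp01 a)) (hmul (hind01 _ a) (hp01₀ a)), fun a ha => ?_,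
    fun s hs => ?_, fun hzero => ?_⟩
  · have h0 : a ∉ D₀ := fun h => ha (hsub h)
    simp [ha, h0]
  · have hsm : Measurable[G] (s.indicator (1 : A → ℝ)) := (@measurable_const _ _ _ G 1).indicator hs
    have h1 := horth hD₀ hpm₀ hp01₀ hp₀ (hsm.mul hpm) fun a => hmul (hind01 s a) (hp01 a)
    have h2 := horth hD hpm hp01 hp (hsm.mul hpm₀) fun a => hmul (hind01 s a) (hp01₀ a)
    have hbint : ∀ {v : A → ℝ}, Measurable v → (∀ a, |v a| ≤ 1) → Integrable v μ := fun hv hv1 =>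
      Integrable.of_bound hv.aestronglyMeasurable 1 (Eventually.of_forall hv1)
    have hi1 : Integrable
        (fun a => (s.indicator (1 : A → ℝ) * p) a * (p₀ a - D₀.indicator 1 a)) μ :=
      hbint (((hsm.mul hpm).mono hG le_rfl).mul (hpm₀'.sub (hindm hD₀))) fun a => by
        rw [abs_mul]
        refine mul_le_one₀ ?_ (abs_nonneg _) (habs (hp01₀ a) (hind01 _ a))
        have := hmul (hind01 s a) (hp01 a)
        rw [Pi.mul_apply, abs_of_nonneg this.1]; exact this.2
    have hi2 : Integrable (fun a => (s.indicator (1 : A → ℝ) * p₀) a * (p a - D.indicator 1 a)) μ :=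
      hbint (((hsm.mul hpm₀).mono hG le_rfl).mul (hpm'.sub (hindm hD))) fun a => by
        rw [abs_mul]
        refine mul_le_one₀ ?_ (abs_nonneg _) (habs (hp01 a) (hind01 _ a))
        have := hmul (hind01 s a) (hp01₀ a)
        rw [Pi.mul_apply, abs_of_nonneg this.1]; exact this.2
    rw [← integral_indicator (hG s hs)]
    have h3 : ∫ a, ((s.indicator (1 : A → ℝ) * p₀) a * (p a - D.indicator 1 a) -
        (s.indicator (1 : A → ℝ) * p) a * (p₀ a - D₀.indicator 1 a)) ∂μ = 0 := by
      rw [integral_sub hi2 hi1, h1, h2, sub_self]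
    rw [← h3]
    refine integral_congr_ae (Eventually.of_forall fun a => ?_)
    by_cases h : a ∈ s
    · simp [h]; ring
    · simp [h]
  · -- if the perturbation vanishes then `D₀` is the trace of a `G`-measurable set
    have hD1 : MeasurableSet[G] {a | p₀ a = p a} := measurableSet_eq_fun (m := G) hpm₀ hpm
    have hP0 : MeasurableSet[G] {a | p a = 0} := hpm (measurableSet_singleton 0)
    have hnull : μ ({a | p a = 0} ∩ D) = 0 := by
      have h1 := hp _ hP0
      have h2 : ∫ a in {a | p a = 0}, (p a - D.indicator 1 a) ∂μ =
          - ∫ a in {a | p a = 0}, D.indicator (1 : A → ℝ) a ∂μ := by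
        rw [← integral_neg]
        refine setIntegral_congr_fun (hG _ hP0) fun a ha => ?_
        have : p a = 0 := ha
        simp [this]
      rw [h2, neg_eq_zero, setIntegral_indicator hD] at h1
      rw [show ∫ a in {a | p a = 0} ∩ D, (1 : A → ℝ) a ∂μ = μ.real ({a | p a = 0} ∩ D) by
        simp] at h1
      exact (measureReal_eq_zero_iff (measure_ne_top _ _)).1 h1
    refine hne _ hD1 (measure_mono_null ?_ (measure_union_null hnull hzero))
    intro a ha
    by_contra hnot
    rw [mem_union, not_or] at hnot
    have hz : D₀.indicator 1 a * p a - D.indicator 1 a * p₀ a = 0 := by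
      by_contra h; exact hnot.2 h
    rcases ha with ⟨h0, h1⟩ | ⟨⟨h0, hDa⟩, h1⟩
    · have hDa := hsub h0
      refine h1 ⟨?_, hDa⟩
      simp [h0, hDa] at hz
      show p₀ a = p a
      linarith
    · simp [h1, hDa] at hz
      have h2 : p₀ a = p a := h0
      exact hnot.1 ⟨show p a = 0 by rw [← h2]; exact hz, hDa⟩

/-- A behavioral strategy which maximizes a weakly continuous affine functional can be replaced by
a pure strategy with the same conditional distributions given a sub-σ-algebra without conditional
atoms. -/
lemma exists_pureStrategy_of_hasNoCondAtom {A B : Type} {G mA : MeasurableSpace A} [Fintype B]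
    [Nonempty B] (μ : Measure A) [IsProbabilityMeasure μ] (hG : G ≤ mA)
    (hna : HasNoCondAtom mA G μ) {g : A → B → ℝ} (hg : IsBehavioral g) (L : (A → B → ℝ) → ℝ)
    (hLcont : ∀ (α : Type) (l : Filter α) (H : α → A → B → ℝ) (h : A → B → ℝ),
      (∀ k, IsBehavioral (H k)) → IsBehavioral h → WeakTendsto μ H l h →
      Tendsto (fun k => L (H k)) l (𝓝 (L h)))
    (hLaff : ∀ h₁ h₂ : A → B → ℝ, IsBehavioral h₁ → IsBehavioral h₂ →
      L (fun a b => (h₁ a b + h₂ a b) / 2) = (L h₁ + L h₂) / 2)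
    (hLmax : ∀ h, IsBehavioral h → L h ≤ L g) :
    ∃ f : A → B, IsPureStrategy f ∧
      (∀ b s, MeasurableSet[G] s → ∫ a in s, diracStrategy f a b ∂μ = ∫ a in s, g a b ∂μ) ∧
      L (diracStrategy f) = L g := by
  classical
  let ev : (A → B → ℝ) → ({s : Set A // MeasurableSet s} × B) → ℝ :=
    fun h p => ∫ a in p.1.1, h a p.2 ∂μ
  let S : Set (A → B → ℝ) := {h | IsBehavioral h ∧
    (∀ b s, MeasurableSet[G] s → ∫ a in s, h a b ∂μ = ∫ a in s, g a b ∂μ) ∧ L h = L g}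
  have hgS : g ∈ S := ⟨hg, fun _ _ _ => rfl, rfl⟩
  have hK : IsCompact (ev '' S) := by
    rw [isCompact_iff_ultrafilter_le_nhds]
    intro l hl
    have hlK : ev '' S ∈ l := by simpa using hl
    let H : (({s : Set A // MeasurableSet s} × B) → ℝ) → A → B → ℝ :=
      fun e => if he : e ∈ ev '' S then he.choose else g
    have hH : ∀ e ∈ ev '' S, H e ∈ S ∧ ev (H e) = e := by
      intro e he
      simp only [H, dif_pos he]
      exact he.choose_spec
    have hHb : ∀ e, IsBehavioral (H e) := by
      intro e
      by_cases he : e ∈ ev '' S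
      · exact (hH e he).1.1
      · simp only [H, dif_neg he]; exact hg
    obtain ⟨h, hh, hlim⟩ := exists_weakTendsto_of_ultrafilter μ l hHb
    refine ⟨ev h, ⟨h, ⟨hh, fun b s hs => ?_, ?_⟩, rfl⟩, ?_⟩
    · refine tendsto_nhds_unique (hlim b s (hG s hs)) (tendsto_const_nhds.congr' ?_)
      filter_upwards [hlK] with e he
      exact ((hH e he).1.2.1 b s hs).symm
    · refine tendsto_nhds_unique (hLcont _ _ _ _ hHb hh hlim) (tendsto_const_nhds.congr' ?_)
      filter_upwards [hlK] with e he
      exact (hH e he).1.2.2.symm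
    · have h1 : Tendsto (fun e => ev (H e)) l (𝓝 (ev h)) :=
        tendsto_pi_nhds.2 fun p => hlim p.2 p.1.1 p.1.2
      have h2 : Tendsto id (l : Filter _) (𝓝 (ev h)) := h1.congr' (by
        filter_upwards [hlK] with e he using (hH e he).2)
      exact h2
  obtain ⟨_, hext⟩ := hK.extremePoints_nonempty (⟨_, g, hgS, rfl⟩ : (ev '' S).Nonempty)
  obtain ⟨⟨h, ⟨hh, hhG, hhL⟩, rfl⟩, hext⟩ := mem_extremePoints.1 hext
  have hnull : ∀ x y, x ≠ y → ∀ ε : ℝ, 0 < ε → μ {a | ε ≤ h a x ∧ ε ≤ h a y} = 0 := by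
    intro x y hxy ε hε
    by_contra hpos
    have hD : MeasurableSet {a | ε ≤ h a x ∧ ε ≤ h a y} :=
      (measurableSet_le measurable_const (hh.1 x)).inter
        (measurableSet_le measurable_const (hh.1 y))
    obtain ⟨φ, hφm, hφ1, hφD, hφ0, hφne⟩ :=
      exists_perturbation_of_not_isCondAtom μ hG hD (pos_iff_ne_zero.2 hpos) (hna _)
    have hφi : Integrable φ μ :=
      Integrable.of_bound hφm.aestronglyMeasurable 1 (Eventually.of_forall hφ1)
    let d : B → ℝ := fun b => (if b = x then 1 else 0) - (if b = y then 1 else 0)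
    let H : ℝ → A → B → ℝ := fun c a b => h a b + φ a * (c * d b)
    have hHint : ∀ c b s, MeasurableSet s →
        ∫ a in s, H c a b ∂μ = ∫ a in s, h a b ∂μ + (∫ a in s, φ a ∂μ) * (c * d b) := by
      intro c b s _
      rw [← integral_mul_const]
      exact integral_add (hh.integrable μ b).integrableOn (hφi.mul_const _).integrableOn
    have hHb : ∀ c, |c| ≤ ε → IsBehavioral (H c) := by
      intro c hc
      refine ⟨fun b => (hh.1 b).add (hφm.mul_const _), fun a => ⟨fun b => ?_, ?_⟩⟩
      · by_cases ha : ε ≤ h a x ∧ ε ≤ h a y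
        · have h1 : |φ a * c| ≤ ε := by
            rw [abs_mul]
            calc |φ a| * |c| ≤ 1 * ε := mul_le_mul (hφ1 a) hc (abs_nonneg _) zero_le_one
              _ = ε := one_mul ε
          have h2 := abs_le.1 h1
          have h3 := (hh.2 a).1 b
          simp only [H, d]
          rw [← mul_assoc]
          by_cases hbx : b = x
          · subst hbx
            simp only [if_true, if_neg hxy]
            linarith [ha.1]
          · by_cases hby : b = y
            · subst hby
              simp only [if_true, if_neg hbx]
              linarith [ha.2]
            · simp only [if_neg hbx, if_neg hby]
              linarith
        · simp only [H, hφD a ha, zero_mul, add_zero]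
          exact (hh.2 a).1 b
      · simp only [H, d]
        rw [Finset.sum_add_distrib, ← Finset.mul_sum, ← Finset.mul_sum, (hh.2 a).2]
        simp
    have hHS : ∀ c, |c| ≤ ε → H c ∈ S := by
      intro c hc
      have hc' : |-c| ≤ ε := by rwa [abs_neg]
      refine ⟨hHb c hc, fun b s hs => ?_, ?_⟩
      · rw [hHint c b s (hG s hs), hφ0 s hs, zero_mul, add_zero, hhG b s hs]
      · have h1 := hLaff _ _ (hHb c hc) (hHb (-c) hc')
        have h2 : (fun a b => (H c a b + H (-c) a b) / 2) = h := by
          funext a b; simp only [H]; ring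
        rw [h2, hhL] at h1
        have h3 := hLmax _ (hHb c hc)
        have h4 := hLmax _ (hHb (-c) hc')
        linarith
    have hε1 : |ε| ≤ ε := (abs_of_pos hε).le
    have hε2 : |-ε| ≤ ε := by rwa [abs_neg]
    have hseg : ev h ∈ openSegment ℝ (ev (H ε)) (ev (H (-ε))) := by
      refine ⟨1 / 2, 1 / 2, by norm_num, by norm_num, by norm_num, ?_⟩
      funext p
      simp only [Pi.add_apply, Pi.smul_apply, smul_eq_mul, ev]
      rw [hHint _ _ _ p.1.2, hHint _ _ _ p.1.2]
      ring
    have heq := hext _ ⟨_, hHS ε hε1, rfl⟩ _ ⟨_, hHS (-ε) hε2, rfl⟩ hseg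
    refine hφne (hφi.ae_eq_zero_of_forall_setIntegral_eq_zero fun s hs _ => ?_)
    have h1 := congrFun heq.1 (⟨s, hs⟩, x)
    simp only [ev] at h1
    rw [hHint _ _ _ hs] at h1
    simpa [d, hxy, hε.ne'] using h1
  have hone : ∀ᵐ a ∂μ, ∃ b, h a b = 1 := by
    have h1 : ∀ᵐ a ∂μ, ∀ x y, x ≠ y → ∀ n : ℕ,
        ¬ (1 / ((n : ℝ) + 1) ≤ h a x ∧ 1 / ((n : ℝ) + 1) ≤ h a y) := by
      rw [ae_all_iff]; intro x
      rw [ae_all_iff]; intro y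
      rw [eventually_imp_distrib_left]; intro hxy
      rw [ae_all_iff]; intro n
      rw [ae_iff]
      simpa using hnull x y hxy (1 / ((n : ℝ) + 1)) (by positivity)
    filter_upwards [h1] with a ha
    have h2 : ∃ x ∈ Finset.univ, 0 < h a x := by
      by_contra! hcon
      have := Finset.sum_nonpos hcon
      rw [(hh.2 a).2] at this
      linarith
    obtain ⟨x, -, hx⟩ := h2
    refine ⟨x, ?_⟩
    rw [← (hh.2 a).2, Finset.sum_eq_single x]
    · intro y _ hyx
      by_contra hy0
      have hy : 0 < h a y := lt_of_le_of_ne ((hh.2 a).1 y) (Ne.symm hy0)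
      obtain ⟨n, hn⟩ := exists_nat_one_div_lt (lt_min hx hy)
      exact ha x y (Ne.symm hyx) n
        ⟨hn.le.trans (min_le_left _ _), hn.le.trans (min_le_right _ _)⟩
    · simp
  have huniq : ∀ {a x y}, h a x = 1 → h a y ≠ 0 → x = y := by
    intro a x y hx hy
    by_contra hxy
    have h1 := Finset.add_le_sum (fun b _ => (hh.2 a).1 b) (Finset.mem_univ x)
      (Finset.mem_univ y) hxy
    rw [(hh.2 a).2, hx] at h1
    exact hy (le_antisymm (by linarith) ((hh.2 a).1 y))
  let f : A → B := fun a => if ha : ∃ b, h a b = 1 then ha.choose else Classical.arbitrary B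
  have hf : ∀ {a}, (∃ b, h a b = 1) → h a (f a) = 1 := by
    intro a ha
    simp only [f, dif_pos ha]
    exact ha.choose_spec
  have hfp : IsPureStrategy f := by
    intro b
    have hm : ∀ c, MeasurableSet {a | h a c = 1} := fun c => hh.1 c (measurableSet_singleton 1)
    have hset : {a | f a = b} =
        {a | h a b = 1} ∪ ({a | b = Classical.arbitrary B} ∩ ⋂ c, {a | h a c = 1}ᶜ) := by
      ext a
      simp only [mem_union, mem_inter_iff, mem_iInter, mem_compl_iff, mem_ofPred_eq]
      by_cases ha : ∃ c, h a c = 1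
      · have hfa := hf ha
        constructor
        · rintro rfl; exact Or.inl hfa
        · rintro (h1 | h1)
          · exact huniq hfa (by rw [h1]; exact one_ne_zero)
          · obtain ⟨c, hc⟩ := ha
            exact absurd hc (h1.2 c)
      · have hfa : f a = Classical.arbitrary B := by simp only [f, dif_neg ha]
        rw [hfa]
        push Not at ha
        constructor
        · rintro rfl; exact Or.inr ⟨rfl, ha⟩
        · rintro (h1 | h1)
          · exact absurd h1 (ha b)
          · exact h1.1.symm
    rw [hset]
    exact (hm b).union ((MeasurableSet.const _).inter (MeasurableSet.iInter fun c => (hm c).compl))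
  have hae : ∀ b, (fun a => diracStrategy f a b) =ᵐ[μ] fun a => h a b := by
    intro b
    filter_upwards [hone] with a ha
    have hfa := hf ha
    simp only [diracStrategy]
    split_ifs with hb
    · rw [← hb, hfa]
    · by_contra hne
      exact hb (huniq hfa (Ne.symm hne))
  have hset : ∀ b s, ∫ a in s, diracStrategy f a b ∂μ = ∫ a in s, h a b ∂μ := fun b s =>
    integral_congr_ae (ae_restrict_of_ae (hae b))
  refine ⟨f, hfp, fun b s hs => by rw [hset, hhG b s hs], ?_⟩
  rw [← hhL]
  refine tendsto_nhds_unique (hLcont Unit (pure ()) (fun _ => h) _ (fun _ => hh)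
    (isBehavioral_diracStrategy hfp) fun b s _ => ?_) tendsto_const_nhds
  rw [hset]
  exact tendsto_const_nhds

end Purification

section BehavioralPayoff

lemma isBehavioral_update {ι : Type*} [DecidableEq ι] {T X : ι → Type*}
    [∀ i, MeasurableSpace (T i)] [∀ i, Fintype (X i)]
    {G : ∀ i, T i → X i → ℝ} (hG : ∀ i, IsBehavioral (G i)) {i : ι}
    {h : T i → X i → ℝ} (hh : IsBehavioral h) (j : ι) :
    IsBehavioral (Function.update G i h j) := by
  by_cases hj : j = i
  · subst hj; simpa using hh
  · simpa [hj] using hG j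

variable {ι : Type*} [Fintype ι] {T X : ι → Type*}

lemma prod_update_strategy [DecidableEq ι] (G : ∀ i, T i → X i → ℝ) (i : ι) (h : T i → X i → ℝ)
    (t : ∀ i, T i) (x : ∀ i, X i) :
    ∏ j, Function.update G i h j (t j) (x j) =
      h (t i) (x i) * ∏ j ∈ Finset.univ.erase i, G j (t j) (x j) := by
  rw [← Finset.mul_prod_erase _ _ (Finset.mem_univ i), Function.update_self]
  congr 1
  refine Finset.prod_congr rfl fun j hj => ?_
  rw [Function.update_of_ne (Finset.ne_of_mem_erase hj)]

variable [∀ i, MeasurableSpace (T i)] [∀ i, Fintype (X i)]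

lemma integrable_prod_strategy_mul {μ : ∀ i, Measure (T i)}
    {G : ∀ i, T i → X i → ℝ} (hG : ∀ i, IsBehavioral (G i))
    (x : ∀ i, X i) (J : Finset ι) {f : (∀ i, T i) → ℝ} (hf : Integrable f (Measure.pi μ)) :
    Integrable (fun t => (∏ j ∈ J, G j (t j) (x j)) * f t) (Measure.pi μ) := by
  refine hf.bdd_mul (c := 1) (Finset.measurable_prod _ fun i _ =>
    ((hG i).1 (x i)).comp (measurable_pi_apply i)).aestronglyMeasurable
    (Eventually.of_forall fun t => ?_)
  rw [Real.norm_of_nonneg (Finset.prod_nonneg fun i _ => ((hG i).mem_Icc _ _).1)]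
  exact Finset.prod_le_one (fun i _ => ((hG i).mem_Icc _ _).1) fun i _ => ((hG i).mem_Icc _ _).2

variable [DecidableEq ι]

/-- Expected payoff of a profile of behavioral strategies under the product of the marginals. -/
def behavPayoff (μ : ∀ i, Measure (T i)) (w : (∀ i, X i) → (∀ i, T i) → ℝ)
    (G : ∀ i, T i → X i → ℝ) : ℝ :=
  ∑ x : ∀ i, X i, ∫ t, (∏ j, G j (t j) (x j)) * w x t ∂Measure.pi μ

variable {μ : ∀ i, Measure (T i)} {w : (∀ i, X i) → (∀ i, T i) → ℝ}

lemma tendsto_behavPayoff [∀ i, IsProbabilityMeasure (μ i)] {α : Type*} {l : Filter α}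
    (hw : ∀ x, Integrable (w x) (Measure.pi μ))
    {G : α → ∀ i, T i → X i → ℝ} {g : ∀ i, T i → X i → ℝ} (hG : ∀ k i, IsBehavioral (G k i))
    (hg : ∀ i, IsBehavioral (g i)) (hlim : ∀ i, WeakTendsto (μ i) (fun k => G k i) l (g i)) :
    Tendsto (fun k => behavPayoff μ w (G k)) l (𝓝 (behavPayoff μ w g)) := by
  refine tendsto_finsetSum _ fun x _ => ?_
  exact tendsto_integral_prod_mul_of_tendsto_setIntegral μ
    (p := fun k i t => G k i t (x i)) (p₀ := fun i t => g i t (x i))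
    (fun k i => (hG k i).1 (x i)) (fun k i t => (hG k i).mem_Icc t (x i))
    (fun i => (hg i).1 (x i)) (fun i t => (hg i).mem_Icc t (x i))
    (fun i s hs => hlim i (x i) s hs) (hw x)

lemma behavPayoff_update_sum {κ : Type*} [Fintype κ] (hw : ∀ x, Integrable (w x) (Measure.pi μ))
    {G : ∀ i, T i → X i → ℝ} (hG : ∀ i, IsBehavioral (G i)) (i : ι) (c : κ → ℝ)
    {H : κ → T i → X i → ℝ} (hH : ∀ k, IsBehavioral (H k)) :
    behavPayoff μ w (Function.update G i fun a b => ∑ k, c k * H k a b) =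
      ∑ k, c k * behavPayoff μ w (Function.update G i (H k)) := by
  simp only [behavPayoff, Finset.mul_sum]
  rw [Finset.sum_comm]
  refine Finset.sum_congr rfl fun x _ => ?_
  simp_rw [← integral_const_mul]
  rw [← integral_finsetSum]
  · refine integral_congr_ae (Eventually.of_forall fun t => ?_)
    simp only [prod_update_strategy, Finset.sum_mul]
    exact Finset.sum_congr rfl fun k _ => by ring
  · intro k _
    exact (integrable_prod_strategy_mul (isBehavioral_update hG (hH k)) x Finset.univ
      (hw x)).const_mul (c k)

lemma map_update_prod (μ : ∀ i, Measure (T i)) [∀ i, IsProbabilityMeasure (μ i)] (j : ι) :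
    Measure.map (fun p : (∀ i, T i) × T j => Function.update p.1 j p.2)
      ((Measure.pi μ).prod (μ j)) = Measure.pi μ := by
  refine (Measure.pi_eq fun s hs => ?_).symm
  rw [Measure.map_apply measurable_update' (MeasurableSet.univ_pi hs)]
  have hpre : (fun p : (∀ i, T i) × T j => Function.update p.1 j p.2) ⁻¹' univ.pi s =
      (univ.pi (Function.update s j univ)) ×ˢ s j := by
    ext ⟨a, b⟩
    simp only [mem_preimage, mem_univ_pi, mem_prod]
    constructor
    · intro h
      refine ⟨fun i => ?_, by simpa using h j⟩
      by_cases hi : i = j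
      · subst hi; simp
      · simpa [hi] using h i
    · rintro ⟨h1, h2⟩ i
      by_cases hi : i = j
      · subst hi; simpa using h2
      · simpa [hi] using h1 i
  rw [hpre, Measure.prod_prod, Measure.pi_pi, ← Finset.mul_prod_erase _ _ (Finset.mem_univ j),
    ← Finset.mul_prod_erase Finset.univ (fun i => μ i (s i)) (Finset.mem_univ j),
    Function.update_self, measure_univ, one_mul, mul_comm]
  congr 1
  refine Finset.prod_congr rfl fun i hi => ?_
  rw [Function.update_of_ne (Finset.ne_of_mem_erase hi)]

lemma behavPayoff_diracStrategy (hw : ∀ x, Integrable (w x) (Measure.pi μ))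
    {f : ∀ i, T i → X i} (hf : ∀ i, IsPureStrategy (f i)) :
    behavPayoff μ w (fun i => diracStrategy (f i)) =
      ∫ t, w (fun i => f i (t i)) t ∂Measure.pi μ := by
  classical
  rw [behavPayoff, ← integral_finsetSum]
  · refine integral_congr_ae (Eventually.of_forall fun t => ?_)
    dsimp only
    rw [Finset.sum_eq_single fun i => f i (t i)]
    · simp [diracStrategy]
    · intro x _ hx
      obtain ⟨i, hi⟩ := Function.ne_iff.1 hx
      rw [Finset.prod_eq_zero (Finset.mem_univ i), zero_mul]
      simp [diracStrategy, Ne.symm hi]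
    · simp
  · intro x _
    exact integrable_prod_strategy_mul (fun i => isBehavioral_diracStrategy (hf i)) x
      Finset.univ (hw x)

end BehavioralPayoff

/-- Payoffs depend on the strategy of player `j` only through its integrals over sets of a
σ-algebra for which all sections of the payoff functions are measurable. -/
lemma behavPayoff_update_congr {ι : Type*} [Fintype ι] [DecidableEq ι] {T X : ι → Type*} {j : ι}
    {m : MeasurableSpace (T j)} [mT : ∀ i, MeasurableSpace (T i)] [∀ i, Fintype (X i)]
    {μ : ∀ i, Measure (T i)} [∀ i, IsProbabilityMeasure (μ i)]
    {w : (∀ i, X i) → (∀ i, T i) → ℝ} (hw : ∀ x, Integrable (w x) (Measure.pi μ))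
    {G : ∀ i, T i → X i → ℝ} (hG : ∀ i, IsBehavioral (G i)) (hm : m ≤ mT j)
    (hwm : ∀ x s, Measurable[m] fun τ => w x (Function.update s j τ))
    {h h' : T j → X j → ℝ} (hh : IsBehavioral h) (hh' : IsBehavioral h')
    (heq : ∀ b s, MeasurableSet[m] s → ∫ a in s, h a b ∂μ j = ∫ a in s, h' a b ∂μ j) :
    behavPayoff μ w (Function.update G j h) = behavPayoff μ w (Function.update G j h') := by
  refine Finset.sum_congr rfl fun x _ => ?_
  have hi := integrable_prod_strategy_mul (isBehavioral_update hG hh) x Finset.univ (hw x)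
  have hi' := integrable_prod_strategy_mul (isBehavioral_update hG hh') x Finset.univ (hw x)
  rw [← sub_eq_zero, ← integral_sub hi hi']
  let F : (∀ i, T i) → ℝ := fun t => (∏ i ∈ Finset.univ.erase j, G i (t i) (x i)) * w x t
  have hF : Integrable F (Measure.pi μ) := integrable_prod_strategy_mul hG x _ (hw x)
  have hFk : Integrable (fun t => F t * (h (t j) (x j) - h' (t j) (x j))) (Measure.pi μ) := by
    refine (hi.sub hi').congr (Eventually.of_forall fun t => ?_)
    simp only [Pi.sub_apply, prod_update_strategy, F]
    ring
  have hcongr : ∫ t, ((∏ i, Function.update G j h i (t i) (x i)) * w x t -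
      (∏ i, Function.update G j h' i (t i) (x i)) * w x t) ∂Measure.pi μ =
      ∫ t, F t * (h (t j) (x j) - h' (t j) (x j)) ∂Measure.pi μ := by
    refine integral_congr_ae (Eventually.of_forall fun t => ?_)
    simp only [prod_update_strategy, F]
    ring
  rw [hcongr]
  have hup : Measurable fun p : (∀ i, T i) × T j => Function.update p.1 j p.2 := measurable_update'
  have hF' := hF
  have hFk' := hFk
  rw [← map_update_prod μ j] at hF' hFk' ⊢
  rw [integral_map hup.aemeasurable hFk'.aestronglyMeasurable]
  rw [integrable_map_measure hF'.aestronglyMeasurable hup.aemeasurable] at hF'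
  rw [integrable_map_measure hFk'.aestronglyMeasurable hup.aemeasurable] at hFk'
  refine (integral_prod _ hFk').trans (integral_eq_zero_of_ae ?_)
  filter_upwards [hF'.prod_right_ae] with s hs
  have hFs : Measurable[m] fun τ => F (Function.update s j τ) := by
    have : (fun τ => F (Function.update s j τ)) = fun τ =>
        (∏ i ∈ Finset.univ.erase j, G i (s i) (x i)) * w x (Function.update s j τ) := by
      funext τ
      simp only [F]
      congr 1
      refine Finset.prod_congr rfl fun i hi => ?_
      rw [Function.update_of_ne (Finset.ne_of_mem_erase hi)]
    rw [this]
    exact (hwm x s).const_mul _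
  simp only [Function.comp_apply, Function.update_self, Pi.zero_apply]
  refine integral_mul_eq_zero_of_forall_setIntegral_eq_zero (μ j) hm
    (k := fun τ => h τ (x j) - h' τ (x j)) ((hh.1 _).sub (hh'.1 _)) (C := 1) (fun a => ?_)
    (fun s hs => ?_) hFs hs
  · rw [Real.norm_eq_abs, abs_le]
    have h1 := hh.mem_Icc a (x j)
    have h2 := hh'.mem_Icc a (x j)
    constructor <;> linarith [h1.1, h1.2, h2.1, h2.2]
  · rw [integral_sub (hh.integrable (μ j) _).integrableOn (hh'.integrable (μ j) _).integrableOn,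
      heq _ s hs, sub_self]

section Equilibrium

lemma weakTendsto_update {ι α : Type*} [DecidableEq ι] {T X : ι → Type*}
    [∀ i, MeasurableSpace (T i)] {μ : ∀ i, Measure (T i)} {l : Filter α}
    {G : α → ∀ i, T i → X i → ℝ} {g : ∀ i, T i → X i → ℝ}
    (hG : ∀ i, WeakTendsto (μ i) (fun k => G k i) l (g i)) {i : ι} {H : α → T i → X i → ℝ}
    {h : T i → X i → ℝ} (hH : WeakTendsto (μ i) H l h) (j : ι) :
    WeakTendsto (μ j) (fun k => Function.update (G k) i (H k) j) l (Function.update g i h j) := by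
  by_cases hj : j = i
  · subst hj; simpa using hH
  · simpa [hj] using hG j

lemma weakTendsto_const {α A B : Type*} [MeasurableSpace A] (μ : Measure A) (l : Filter α)
    (g : A → B → ℝ) : WeakTendsto μ (fun _ => g) l g :=
  fun _ _ _ => tendsto_const_nhds

lemma isBehavioral_sum_mul {κ A B : Type*} [Fintype κ] [MeasurableSpace A] [Fintype B]
    {a : κ → ℝ} (ha : a ∈ stdSimplex ℝ κ) {H : κ → A → B → ℝ} (hH : ∀ k, IsBehavioral (H k)) :
    IsBehavioral fun t b => ∑ k, a k * H k t b := by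
  refine ⟨fun b => Finset.measurable_sum _ fun k _ => ((hH k).1 b).const_mul _, fun t =>
    ⟨fun b => Finset.sum_nonneg fun k _ => mul_nonneg (ha.1 k) (((hH k).2 t).1 b), ?_⟩⟩
  rw [Finset.sum_comm, ← ha.2]
  refine Finset.sum_congr rfl fun k _ => ?_
  rw [← Finset.mul_sum, ((hH k).2 t).2, mul_one]

lemma weakTendsto_sum_mul {κ A B : Type*} [Fintype κ] [MeasurableSpace A] [Fintype B]
    (μ : Measure A) [IsFiniteMeasure μ] {H : κ → A → B → ℝ} (hH : ∀ k, IsBehavioral (H k))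
    (a₀ : stdSimplex ℝ κ) :
    WeakTendsto μ (fun (a : stdSimplex ℝ κ) t b => ∑ k, a.1 k * H k t b) (𝓝 a₀)
      (fun t b => ∑ k, a₀.1 k * H k t b) := by
  intro b s _
  have heq : ∀ a : stdSimplex ℝ κ, ∫ t in s, ∑ k, a.1 k * H k t b ∂μ =
      ∑ k, a.1 k * ∫ t in s, H k t b ∂μ := by
    intro a
    rw [integral_finsetSum _ fun k _ => (((hH k).integrable μ b).const_mul _).integrableOn]
    simp_rw [integral_const_mul]
  simp_rw [heq]
  refine Continuous.tendsto (f := fun a : stdSimplex ℝ κ =>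
    ∑ k, a.1 k * ∫ t in s, H k t b ∂μ) ?_ a₀
  exact continuous_finsetSum _ fun k _ =>
    ((continuous_apply k).comp continuous_subtype_val).mul continuous_const

/-- Existence of an equilibrium in behavioral strategies. -/
lemma exists_behavioral_equilibrium {ι : Type*} [Fintype ι] [DecidableEq ι] {T X : ι → Type*}
    [∀ i, MeasurableSpace (T i)] [∀ i, Fintype (X i)] [∀ i, Nonempty (X i)]
    (μ : ∀ i, Measure (T i)) [∀ i, IsProbabilityMeasure (μ i)]
    {w : ι → (∀ i, X i) → (∀ i, T i) → ℝ} (hw : ∀ i x, Integrable (w i x) (Measure.pi μ)) :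
    ∃ g : ∀ i, T i → X i → ℝ, (∀ i, IsBehavioral (g i)) ∧ ∀ i h, IsBehavioral h →
      behavPayoff μ (w i) (Function.update g i h) ≤ behavPayoff μ (w i) g := by
  classical
  let Ψ : (∀ i, T i → X i → ℝ) → (∀ i, T i → X i → ℝ) → ℝ := fun g h =>
    ∑ i, (behavPayoff μ (w i) (Function.update g i (h i)) - behavPayoff μ (w i) g)
  have hΨ : ∀ {α : Type _} {l : Filter α} {G : α → ∀ i, T i → X i → ℝ}
      {g h : ∀ i, T i → X i → ℝ}, (∀ k i, IsBehavioral (G k i)) → (∀ i, IsBehavioral (g i)) →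
      (∀ i, IsBehavioral (h i)) → (∀ i, WeakTendsto (μ i) (fun k => G k i) l (g i)) →
      Tendsto (fun k => Ψ (G k) h) l (𝓝 (Ψ g h)) := by
    intro α l G g h hG hg hh hlim
    refine tendsto_finsetSum _ fun i _ => Tendsto.sub ?_ (tendsto_behavPayoff (hw i) hG hg hlim)
    exact tendsto_behavPayoff (hw i) (fun k => isBehavioral_update (hG k) (hh i))
      (isBehavioral_update hg (hh i)) (weakTendsto_update hlim (weakTendsto_const _ _ _))
  let P := {h : ∀ i, T i → X i → ℝ // ∀ i, IsBehavioral (h i)}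
  let d : P := ⟨fun i => diracStrategy fun _ => Classical.arbitrary (X i), fun i =>
    isBehavioral_diracStrategy fun _ => MeasurableSet.const _⟩
  have hfin : ∀ s : Finset P, ∃ g : P, ∀ h ∈ s, Ψ g.1 h.1 ≤ 0 := by
    intro s
    rcases s.eq_empty_or_nonempty with rfl | hs
    · exact ⟨d, by simp⟩
    have : Nonempty s := hs.to_subtype
    let mix : stdSimplex ℝ s → ∀ i, T i → X i → ℝ := fun a i t x => ∑ k, a.1 k * k.1.1 i t x
    have hmix : ∀ a i, IsBehavioral (mix a i) := fun a i =>
      isBehavioral_sum_mul a.2 fun k : s => k.1.2 i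
    obtain ⟨a, ha⟩ := exists_forall_nonpos_of_sum_mul_eq_zero (ι := s)
      (fun k a => Ψ (mix a) k.1.1)
      (fun k => continuous_iff_continuousAt.2 fun a => hΨ hmix (hmix a) k.1.2 fun i =>
        weakTendsto_sum_mul (μ i) (fun k : s => k.1.2 i) a) fun a => by
        simp only [Ψ, Finset.mul_sum]
        rw [Finset.sum_comm]
        refine Finset.sum_eq_zero fun i _ => ?_
        simp only [mul_sub]
        rw [Finset.sum_sub_distrib, ← Finset.sum_mul, a.2.2, one_mul,
          ← behavPayoff_update_sum (hw i) (hmix a) i a.1 fun k : s => k.1.2 i]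
        change behavPayoff μ (w i) (Function.update (mix a) i (mix a i)) - _ = 0
        rw [Function.update_eq_self, sub_self]
    exact ⟨⟨mix a, hmix a⟩, fun h hh => ha ⟨h, hh⟩⟩
  choose γ hγ using hfin
  let l : Ultrafilter (Finset P) := Ultrafilter.of atTop
  choose g hg hlim using fun i =>
    exists_weakTendsto_of_ultrafilter (μ i) l (G := fun s => (γ s).1 i) fun s => (γ s).2 i
  have hle : ∀ h : P, Ψ g h.1 ≤ 0 := fun h =>
    le_of_tendsto (hΨ (fun s => (γ s).2) hg h.2 hlim) (by
      filter_upwards [Ultrafilter.of_le atTop (eventually_ge_atTop {h})] with s hs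
      exact hγ s h (hs (Finset.mem_singleton_self h)))
  refine ⟨g, hg, fun i h hh => ?_⟩
  have h1 := hle ⟨Function.update g i h, isBehavioral_update hg hh⟩
  simp only [Ψ] at h1
  rw [Finset.sum_eq_single i] at h1
  · rw [Function.update_self] at h1
    linarith
  · intro j _ hj
    rw [Function.update_of_ne hj, Function.update_eq_self, sub_self]
  · simp

/-- An equilibrium in behavioral strategies can be purified if no player has a conditional atom
given a σ-algebra for which the payoffs of the other players are measurable. -/
lemma exists_pure_equilibrium_behavPayoff {ι : Type*} [Fintype ι] [DecidableEq ι]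
    {T X : ι → Type} (G : ∀ i, MeasurableSpace (T i)) [mT : ∀ i, MeasurableSpace (T i)]
    [∀ i, Fintype (X i)] [∀ i, Nonempty (X i)]
    (μ : ∀ i, Measure (T i)) [∀ i, IsProbabilityMeasure (μ i)]
    {w : ι → (∀ i, X i) → (∀ i, T i) → ℝ} (hw : ∀ i x, Integrable (w i x) (Measure.pi μ))
    (hG : ∀ i, G i ≤ mT i)
    (hwG : ∀ i j, i ≠ j → ∀ x s, Measurable[G j] fun τ => w i x (Function.update s j τ))
    (hna : ∀ i, HasNoCondAtom (mT i) (G i) (μ i)) :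
    ∃ f : ∀ i, T i → X i, (∀ i, IsPureStrategy (f i)) ∧ ∀ i d, IsBehavioral d →
      behavPayoff μ (w i) (Function.update (fun j => diracStrategy (f j)) i d) ≤
        behavPayoff μ (w i) fun j => diracStrategy (f j) := by
  obtain ⟨g, hg, hopt⟩ := exists_behavioral_equilibrium μ hw
  have hpur : ∀ i, ∃ f : T i → X i, IsPureStrategy f ∧
      (∀ b s, MeasurableSet[G i] s →
        ∫ a in s, diracStrategy f a b ∂μ i = ∫ a in s, g i a b ∂μ i) ∧
      behavPayoff μ (w i) (Function.update g i (diracStrategy f)) =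
        behavPayoff μ (w i) (Function.update g i (g i)) := by
    intro i
    refine exists_pureStrategy_of_hasNoCondAtom (μ i) (hG i) (hna i) (hg i)
      (fun h => behavPayoff μ (w i) (Function.update g i h)) ?_ ?_ ?_
    · intro α l H h hH hh hlim
      exact tendsto_behavPayoff (hw i) (fun k => isBehavioral_update hg (hH k))
        (isBehavioral_update hg hh)
        (weakTendsto_update (G := fun _ => g) (fun j => weakTendsto_const _ _ _) hlim)
    · intro h₁ h₂ hh₁ hh₂
      have h := behavPayoff_update_sum (hw i) hg i (fun _ : Fin 2 => (1 / 2 : ℝ))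
        (H := ![h₁, h₂]) (by intro k; fin_cases k <;> assumption)
      have hmid : (fun a b => (h₁ a b + h₂ a b) / 2) =
          fun a b => ∑ k : Fin 2, (1 / 2 : ℝ) * (![h₁, h₂] : Fin 2 → T i → X i → ℝ) k a b := by
        funext a b
        simp [Fin.sum_univ_two]
        ring
      rw [hmid, h]
      simp only [Fin.sum_univ_two, Matrix.cons_val_zero, Matrix.cons_val_one]
      ring
    · intro h hh
      simp only [Function.update_eq_self]
      exact hopt i h hh
  choose f hf hfG hfL using hpur
  have hdir : ∀ i, IsBehavioral (diracStrategy (f i)) := fun i => isBehavioral_diracStrategy (hf i)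
  have hswitch : ∀ i d, IsBehavioral d → ∀ J : Finset ι,
      behavPayoff μ (w i) (Function.update (J.piecewise (fun j => diracStrategy (f j)) g) i d) =
        behavPayoff μ (w i) (Function.update g i d) := by
    intro i d hd J
    induction J using Finset.induction_on with
    | empty => simp
    | insert j J hj ih =>
      have hP : ∀ k, IsBehavioral (J.piecewise (fun j => diracStrategy (f j)) g k) := by
        intro k
        by_cases hk : k ∈ J
        · simpa [hk] using hdir k
        · simpa [hk] using hg k
      rw [← ih, Finset.piecewise_insert]
      by_cases hij : i = j
      · subst hij
        rw [Function.update_idem]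
      · rw [Function.update_comm (Ne.symm hij),
          behavPayoff_update_congr (hw i) (isBehavioral_update hP hd) (hG j) (hwG i j hij)
            (hdir j) (hg j) (hfG j)]
        congr 1
        rw [Function.update_eq_self_iff, Function.update_of_ne (Ne.symm hij),
          Finset.piecewise_eq_of_notMem _ _ _ hj]
  have hswitch' : ∀ i d, IsBehavioral d →
      behavPayoff μ (w i) (Function.update (fun j => diracStrategy (f j)) i d) =
        behavPayoff μ (w i) (Function.update g i d) := by
    intro i d hd
    simpa using hswitch i d hd Finset.univ
  refine ⟨f, hf, fun i d hd => ?_⟩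
  have h1 := hswitch' i _ (hdir i)
  rw [Function.update_eq_self i fun j => diracStrategy (f j), hfL i,
    Function.update_eq_self] at h1
  rw [hswitch' i d hd, h1]
  exact hopt i d hd

end Equilibrium

section InterInfo

variable {n : ℕ} {T X : Fin n → Type*} (u : Fin n → (∀ i, X i) → (∀ i, T i) → ℝ)
  (q : (∀ i, T i) → ℝ)

lemma interInfo_le [mT : ∀ i, MeasurableSpace (T i)] (hqm : Measurable q)
    (hum : ∀ i x, Measurable (u i x)) (i : Fin n) : interInfo u q i ≤ mT i := by
  refine iSup_le fun j => iSup_le fun _ => iSup_le fun x => iSup_le fun s => ?_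
  refine Measurable.comap_le ?_
  exact ((hum j x).mul hqm).comp (measurable_update s)

lemma measurable_dwPayoff_update_interInfo {i j : Fin n} (hij : i ≠ j) (x : ∀ k, X k)
    (s : ∀ k, T k) :
    Measurable[interInfo u q j] fun τ => dwPayoff u q i x (Function.update s j τ) := by
  refine measurable_iff_comap_le.2 ?_
  exact le_iSup_of_le i (le_iSup_of_le hij (le_iSup_of_le x
    (le_iSup (fun s : ∀ k, T k => MeasurableSpace.comap
      (fun τ : T j => dwPayoff u q i x (Function.update s j τ)) inferInstance) s)))

end InterInfo

/-- Theorem existence: every Bayesian game with finite actions having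
coarser inter-player information (for each player `i`, `𝒯_i` has no `𝒢_i`-atom under the
marginal `λ_i`, where `𝒢_i` is `i`'s inter-player information) possesses a pure strategy
equilibrium. -/
theorem bayesian_game_coarser_interInfo_exists_pure_equilibrium
    (n : ℕ) (hn : 1 ≤ n) (T X : Fin n → Type)
    [mT : ∀ i, MeasurableSpace (T i)]
    (hcg : ∀ i, MeasurableSpace.CountablyGenerated (T i))
    [∀ i, Fintype (X i)] [∀ i, Nonempty (X i)]
    (lamM : ∀ i, Measure (T i)) [∀ i, IsProbabilityMeasure (lamM i)]
    (hatomless : ∀ i, AtomlessMeasure (lamM i))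
    (lam : Measure (∀ i, T i)) [IsProbabilityMeasure lam]
    (hmarg : ∀ i, lam.map (fun t => t i) = lamM i)
    (q : (∀ i, T i) → ℝ) (hqm : Measurable q) (hq0 : ∀ t, 0 ≤ q t)
    (hac : lam = (Measure.pi lamM).withDensity fun t => ENNReal.ofReal (q t))
    (u : Fin n → (∀ i, X i) → (∀ i, T i) → ℝ)
    (hum : ∀ i x, Measurable (u i x))
    (hubd : ∃ h : (∀ i, T i) → ℝ, Integrable h lam ∧
      ∀ i x, ∀ᵐ t ∂lam, |u i x t| ≤ h t)
    (hcoarser : ∀ i, HasNoCondAtom (mT i) (interInfo u q i) (lamM i)) :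
    ∃ f : ∀ i, T i → X i, IsPureEquilibrium lam u f := by
  obtain ⟨h, hh, hubd⟩ := hubd
  have hdm : Measurable fun t => ENNReal.ofReal (q t) := hqm.ennreal_ofReal
  have htop : ∀ᵐ t ∂Measure.pi lamM, ENNReal.ofReal (q t) < ∞ :=
    Eventually.of_forall fun _ => ENNReal.ofReal_lt_top
  have hw : ∀ i x, Integrable (dwPayoff u q i x) (Measure.pi lamM) := by
    intro i x
    have hi : Integrable (u i x) lam :=
      hh.mono' (hum i x).aestronglyMeasurable (by simpa only [Real.norm_eq_abs] using hubd i x)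
    rw [hac, integrable_withDensity_iff_integrable_smul' hdm htop] at hi
    refine hi.congr (Eventually.of_forall fun t => ?_)
    simp only [dwPayoff, ENNReal.toReal_ofReal (hq0 t), smul_eq_mul, mul_comm]
  have hpay : ∀ (f : ∀ i, T i → X i) i, (∀ j, IsPureStrategy (f j)) → purePayoff lam u f i =
      behavPayoff lamM (dwPayoff u q i) fun j => diracStrategy (f j) := by
    intro f i hf
    rw [behavPayoff_diracStrategy (hw i) hf, purePayoff, hac,
      integral_withDensity_eq_integral_toReal_smul hdm htop]
    refine integral_congr_ae (Eventually.of_forall fun t => ?_)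
    simp only [dwPayoff, ENNReal.toReal_ofReal (hq0 t), smul_eq_mul, mul_comm]
  obtain ⟨f, hf, hopt⟩ := exists_pure_equilibrium_behavPayoff (interInfo u q) lamM hw
    (interInfo_le u q hqm hum)
    (fun i j hij x s => measurable_dwPayoff_update_interInfo u q hij x s) hcoarser
  refine ⟨f, hf, fun i g hg => ?_⟩
  have hup : ∀ j, IsPureStrategy (Function.update f i g j) := by
    intro j
    by_cases hj : j = i
    · subst hj; simpa using hg
    · simpa [hj] using hf j
  have hdir : (fun j => diracStrategy (Function.update f i g j)) =
      Function.update (fun j => diracStrategy (f j)) i (diracStrategy g) := by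
    funext j
    by_cases hj : j = i
    · subst hj; simp
    · simp [hj]
  rw [hpay _ i hup, hpay _ i hf, hdir]
  exact hopt i _ (isBehavioral_diracStrategy hg)
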